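/- Let G be an even-hole-free graph, let H be a hole in G, and let a be a vertex of G not in V(H). If G admits no full star cutset with centre a, then either a is complete or anticomplete to V(H), or the subgraph of H induced on V(H)∩N(a) is a path, or a has exactly three neighbours in V(H) and two of them are adjacent. -/

import Mathlib

open SimpleGraph

namespace EHF

variable {V : Type*} {W : Type*} {U : Type*}

/-- The closed neighbourhood `N[a]` of a vertex `a`. -/
def closedNbhd (G : SimpleGraph V) (a : V) : Set V := insert a (G.neighborSet a)

/-- A hole: an induced cycle of length at least four. -/
def IsHole (G : SimpleGraph V) {v : V} (c : G.Walk v v) : Prop :=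
  c.IsCycle ∧ 4 ≤ c.length ∧
    ∀ x y : V, x ∈ c.support → y ∈ c.support → G.Adj x y → s(x, y) ∈ c.edges

/-- A graph is even-hole-free if it has no hole with an even number of vertices. -/
def EvenHoleFree (G : SimpleGraph V) : Prop :=
  ∀ (v : V) (c : G.Walk v v), IsHole G c → ¬ Even c.length

/-- A vertex is bisimplicial if its neighbourhood is the union of two cliques. -/
def Bisimplicial (G : SimpleGraph V) (v : V) : Prop :=
  ∃ K₁ K₂ : Set V, G.IsClique K₁ ∧ G.IsClique K₂ ∧ G.neighborSet v = K₁ ∪ K₂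

/-- `F` induces a connected subgraph of `G`. -/
def ConnectedSubset (G : SimpleGraph V) (F : Set V) : Prop :=
  F.Nonempty ∧ ∀ x ∈ F, ∀ y ∈ F, ∃ p : G.Walk x y, ∀ z ∈ p.support, z ∈ F

/-- `F` is the vertex set of a connected component of `G` minus the vertex set `S`. -/
def IsComponentOf (G : SimpleGraph V) (S F : Set V) : Prop :=
  ConnectedSubset G F ∧ Disjoint F S ∧
    ∀ x ∈ F, ∀ y : V, y ∉ S → G.Adj x y → y ∈ F

/-- The set of vertices of `S` having a neighbour in `F`. -/
def Att (G : SimpleGraph V) (S F : Set V) : Set V :=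
  {v ∈ S | ∃ x ∈ F, G.Adj v x}

/-- A cutset: the rest of the graph is the union of two nonempty sets that are
anticomplete to each other. -/
def IsCutset (G : SimpleGraph V) (C : Set V) : Prop :=
  ∃ X Y : Set V, X.Nonempty ∧ Y.Nonempty ∧ Disjoint X Y ∧ X ∪ Y = Cᶜ ∧
    ∀ x ∈ X, ∀ y ∈ Y, ¬ G.Adj x y

/-- `G` has a full star cutset with centre `v`. -/
def FullStarCutset (G : SimpleGraph V) (v : V) : Prop :=
  IsCutset G (closedNbhd G v)

/-- A walk is induced if every edge of `G` between vertices of the walk is an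
edge of the walk. -/
def InducedWalk (G : SimpleGraph V) {x y : V} (P : G.Walk x y) : Prop :=
  ∀ u v : V, u ∈ P.support → v ∈ P.support → G.Adj u v → s(u, v) ∈ P.edges

/-- A theta with ends `u,w` and constituent paths `P₁,P₂,P₃`, as an induced
subgraph of `G`. -/
def IsThetaIn (G : SimpleGraph V) (u w : V) (P₁ P₂ P₃ : G.Walk u w) : Prop :=
  u ≠ w ∧ P₁.IsPath ∧ P₂.IsPath ∧ P₃.IsPath ∧
  2 ≤ P₁.length ∧ 2 ≤ P₂.length ∧ 2 ≤ P₃.length ∧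
  (∀ v : V, v ∈ P₁.support → v ∈ P₂.support → v = u ∨ v = w) ∧
  (∀ v : V, v ∈ P₁.support → v ∈ P₃.support → v = u ∨ v = w) ∧
  (∀ v : V, v ∈ P₂.support → v ∈ P₃.support → v = u ∨ v = w) ∧
  (∀ x y : V, (x ∈ P₁.support ∨ x ∈ P₂.support ∨ x ∈ P₃.support) →
    (y ∈ P₁.support ∨ y ∈ P₂.support ∨ y ∈ P₃.support) → G.Adj x y →
    s(x, y) ∈ P₁.edges ∨ s(x, y) ∈ P₂.edges ∨ s(x, y) ∈ P₃.edges)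

/-- A near-prism with bases `{a₁,a₂,a₃}`, `{b₁,b₂,b₃}` and constituent paths
`R₁,R₂,R₃`, as an induced subgraph of `G`. -/
def IsNearPrismIn (G : SimpleGraph V) (a₁ a₂ a₃ b₁ b₂ b₃ : V)
    (R₁ : G.Walk a₁ b₁) (R₂ : G.Walk a₂ b₂) (R₃ : G.Walk a₃ b₃) : Prop :=
  G.Adj a₁ a₂ ∧ G.Adj a₁ a₃ ∧ G.Adj a₂ a₃ ∧
  G.Adj b₁ b₂ ∧ G.Adj b₁ b₃ ∧ G.Adj b₂ b₃ ∧
  (({a₁, a₂, a₃} : Set V) ∩ ({b₁, b₂, b₃} : Set V) = ({a₃} : Set V) ∩ ({b₃} : Set V)) ∧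
  R₁.IsPath ∧ R₂.IsPath ∧ R₃.IsPath ∧
  (∀ v : V, v ∈ R₁.support → v ∉ R₂.support) ∧
  (∀ v : V, v ∈ R₁.support → v ∉ R₃.support) ∧
  (∀ v : V, v ∈ R₂.support → v ∉ R₃.support) ∧
  (∀ p q : V, (p ∈ R₁.support ∨ p ∈ R₂.support ∨ p ∈ R₃.support) →
    (q ∈ R₁.support ∨ q ∈ R₂.support ∨ q ∈ R₃.support) → G.Adj p q →
    s(p, q) ∈ R₁.edges ∨ s(p, q) ∈ R₂.edges ∨ s(p, q) ∈ R₃.edges ∨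
    s(p, q) = s(a₁, a₂) ∨ s(p, q) = s(a₁, a₃) ∨ s(p, q) = s(a₂, a₃) ∨
    s(p, q) = s(b₁, b₂) ∨ s(p, q) = s(b₁, b₃) ∨ s(p, q) = s(b₂, b₃))

/-- An extended near-prism contained in `G`, with cross-edge `xy` where
`x` lies in the interior of `R₁` and `y` in the interior of `R₂`. -/
def IsExtNearPrismIn (G : SimpleGraph V) (a₁ a₂ a₃ b₁ b₂ b₃ : V)
    (R₁ : G.Walk a₁ b₁) (R₂ : G.Walk a₂ b₂) (R₃ : G.Walk a₃ b₃) (x y : V) : Prop :=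
  G.Adj a₁ a₂ ∧ G.Adj a₁ a₃ ∧ G.Adj a₂ a₃ ∧
  G.Adj b₁ b₂ ∧ G.Adj b₁ b₃ ∧ G.Adj b₂ b₃ ∧
  (({a₁, a₂, a₃} : Set V) ∩ ({b₁, b₂, b₃} : Set V) = ({a₃} : Set V) ∩ ({b₃} : Set V)) ∧
  R₁.IsPath ∧ R₂.IsPath ∧ R₃.IsPath ∧
  (∀ v : V, v ∈ R₁.support → v ∉ R₂.support) ∧
  (∀ v : V, v ∈ R₁.support → v ∉ R₃.support) ∧
  (∀ v : V, v ∈ R₂.support → v ∉ R₃.support) ∧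
  x ∈ R₁.support ∧ x ≠ a₁ ∧ x ≠ b₁ ∧
  y ∈ R₂.support ∧ y ≠ a₂ ∧ y ≠ b₂ ∧
  G.Adj x y ∧
  (∀ p q : V, (p ∈ R₁.support ∨ p ∈ R₂.support ∨ p ∈ R₃.support) →
    (q ∈ R₁.support ∨ q ∈ R₂.support ∨ q ∈ R₃.support) → G.Adj p q →
    s(p, q) ∈ R₁.edges ∨ s(p, q) ∈ R₂.edges ∨ s(p, q) ∈ R₃.edges ∨
    s(p, q) = s(a₁, a₂) ∨ s(p, q) = s(a₁, a₃) ∨ s(p, q) = s(a₂, a₃) ∨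
    s(p, q) = s(b₁, b₂) ∨ s(p, q) = s(b₁, b₃) ∨ s(p, q) = s(b₂, b₃) ∨
    s(p, q) = s(x, y))

/-- There is an extended near-prism contained in `G` such that `a` is an end of
its cross-edge. -/
def ExtNearPrismCrossEnd (G : SimpleGraph V) (a : V) : Prop :=
  ∃ (a₁ a₂ a₃ b₁ b₂ b₃ : V) (R₁ : G.Walk a₁ b₁) (R₂ : G.Walk a₂ b₂)
    (R₃ : G.Walk a₃ b₃) (y : V),
    IsExtNearPrismIn G a₁ a₂ a₃ b₁ b₂ b₃ R₁ R₂ R₃ a y ∨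
    IsExtNearPrismIn G a₁ a₂ a₃ b₁ b₂ b₃ R₁ R₂ R₃ y a

/-- `G` contains an even wheel (as an induced subgraph). -/
def HasEvenWheel (G : SimpleGraph V) : Prop :=
  ∃ (u : V) (c : G.Walk u u) (v : V), IsHole G c ∧ v ∉ c.support ∧
    3 ≤ {x : V | x ∈ c.support ∧ G.Adj v x}.ncard ∧
    ({x : V | x ∈ c.support ∧ G.Adj v x}.ncard = 3 →
      ∀ x y : V, x ∈ c.support → y ∈ c.support → G.Adj v x → G.Adj v y → ¬ G.Adj x y) ∧
    Even {x : V | x ∈ c.support ∧ G.Adj v x}.ncard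

/-- A pyramid with apex `a`, base `{b₁,b₂,b₃}` and constituent paths
`R₁,R₂,R₃`, as an induced subgraph of `G`. -/
def IsPyramidIn (G : SimpleGraph V) (a b₁ b₂ b₃ : V)
    (R₁ : G.Walk a b₁) (R₂ : G.Walk a b₂) (R₃ : G.Walk a b₃) : Prop :=
  G.Adj b₁ b₂ ∧ G.Adj b₁ b₃ ∧ G.Adj b₂ b₃ ∧
  a ≠ b₁ ∧ a ≠ b₂ ∧ a ≠ b₃ ∧
  R₁.IsPath ∧ R₂.IsPath ∧ R₃.IsPath ∧
  (∀ v : V, v ∈ R₁.support → v ∈ R₂.support → v = a) ∧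
  (∀ v : V, v ∈ R₁.support → v ∈ R₃.support → v = a) ∧
  (∀ v : V, v ∈ R₂.support → v ∈ R₃.support → v = a) ∧
  ((2 ≤ R₁.length ∧ 2 ≤ R₂.length) ∨ (2 ≤ R₁.length ∧ 2 ≤ R₃.length) ∨
    (2 ≤ R₂.length ∧ 2 ≤ R₃.length)) ∧
  (∀ p q : V, (p ∈ R₁.support ∨ p ∈ R₂.support ∨ p ∈ R₃.support) →
    (q ∈ R₁.support ∨ q ∈ R₂.support ∨ q ∈ R₃.support) → G.Adj p q →
    s(p, q) ∈ R₁.edges ∨ s(p, q) ∈ R₂.edges ∨ s(p, q) ∈ R₃.edges ∨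
    s(p, q) = s(b₁, b₂) ∨ s(p, q) = s(b₁, b₃) ∨ s(p, q) = s(b₂, b₃))

/-- A vertex `a` is splendid: `V(G)\N[a]` is connected, every neighbour of `a`
has a neighbour in `V(G)\N[a]`, and there is no short pyramid with apex `a`. -/
def Splendid (G : SimpleGraph V) (a : V) : Prop :=
  ConnectedSubset G ((closedNbhd G a)ᶜ) ∧
  (∀ v : V, G.Adj a v → ∃ w : V, w ∉ closedNbhd G a ∧ G.Adj v w) ∧
  ¬ ∃ (b₁ b₂ b₃ : V) (R₁ : G.Walk a b₁) (R₂ : G.Walk a b₂) (R₃ : G.Walk a b₃),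
      IsPyramidIn G a b₁ b₂ b₃ R₁ R₂ R₃ ∧
      (R₁.length = 1 ∨ R₂.length = 1 ∨ R₃.length = 1)

/-- A rung of the strip `(A,B,C)`. -/
def IsRung (G : SimpleGraph V) (A B C : Set V) {x y : V} (P : G.Walk x y) : Prop :=
  P.IsPath ∧ x ∈ A ∧ y ∈ B ∧
  (∀ v ∈ P.support, v ≠ x → v ≠ y → v ∈ C) ∧
  (x ≠ y → x ∉ B ∧ y ∉ A) ∧
  InducedWalk G P

/-- A strip `(A,B,C)`: `A,B` nonempty and disjoint from `C`, and every vertex of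
`A∪B∪C` lies on a rung. -/
def IsStrip (G : SimpleGraph V) (A B C : Set V) : Prop :=
  A.Nonempty ∧ B.Nonempty ∧ Disjoint A C ∧ Disjoint B C ∧
  ∀ v ∈ A ∪ B ∪ C, ∃ (x y : V) (P : G.Walk x y), IsRung G A B C P ∧ v ∈ P.support

/-- A `J`-strip system in `G`. -/
structure StripSystem (G : SimpleGraph V) (J : SimpleGraph W) where
  ME : W → W → Set V
  MV : W → Set V
  me_symm : ∀ u v : W, ME u v = ME v u
  me_disj : ∀ u v w x : W, J.Adj u v → J.Adj w x → s(u, v) ≠ s(w, x) →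
    Disjoint (ME u v) (ME w x)
  mv_sub : ∀ u : W, MV u ⊆ ⋃ (v : W), ⋃ (_ : J.Adj u v), ME u v
  strip : ∀ u v : W, J.Adj u v →
    IsStrip G (ME u v ∩ MV u) (ME u v ∩ MV v) (ME u v \ (MV u ∪ MV v))
  far : ∀ u v w x : W, J.Adj u v → J.Adj w x → u ≠ w → u ≠ x → v ≠ w → v ≠ x →
    ∀ p ∈ ME u v, ∀ q ∈ ME w x, ¬ G.Adj p q
  near : ∀ u v w : W, J.Adj u v → J.Adj u w → v ≠ w →
    ∀ p ∈ ME u v, ∀ q ∈ ME u w, (G.Adj p q ↔ p ∈ MV u ∧ q ∈ MV u)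

/-- `V(M)`: the union of the sets `M_e` over the edges of `J`. -/
def VM {G : SimpleGraph V} {J : SimpleGraph W} (S : StripSystem G J) : Set V :=
  ⋃ (u : W), ⋃ (v : W), ⋃ (_ : J.Adj u v), S.ME u v

/-- A leaf of a graph: a vertex of degree exactly one. -/
def IsLeaf (J : SimpleGraph W) (u : W) : Prop := (J.neighborSet u).ncard = 1

/-- `ab` is a cross-edge for the strip system `S` with partition `(α,β)` of the
leaves of `J`. -/
def IsCrossEdge {G : SimpleGraph V} {J : SimpleGraph W} (S : StripSystem G J)
    (a b : V) (α β : Set W) : Prop :=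
  G.Adj a b ∧
  α ∪ β = {u : W | IsLeaf J u} ∧ Disjoint α β ∧
  (∀ u : W, (J.neighborSet u).ncard ≠ 2) ∧
  3 ≤ Nat.card W ∧
  (∀ u u₁ u₂ : W, u₁ ∈ α → u₂ ∈ α → J.Adj u u₁ → J.Adj u u₂ → u₁ = u₂) ∧
  (∀ u u₁ u₂ : W, u₁ ∈ β → u₂ ∈ β → J.Adj u u₁ → J.Adj u u₂ → u₁ = u₂) ∧
  (∀ u v : W, J.Adj u v → a ∉ S.ME u v ∧ b ∉ S.ME u v) ∧
  (∀ x ∈ VM S, (G.Adj a x ↔ ∃ u ∈ α, x ∈ S.MV u)) ∧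
  (∀ x ∈ VM S, (G.Adj b x ↔ ∃ u ∈ β, x ∈ S.MV u))

/-- A local subset of `V(M)∪{a,b}`. -/
def IsLocal {G : SimpleGraph V} {J : SimpleGraph W} (S : StripSystem G J)
    (a b : V) (α β : Set W) (X : Set V) : Prop :=
  (∃ u v : W, J.Adj u v ∧ X ⊆ S.ME u v) ∨
  (∃ u : W, X ⊆ S.MV u) ∨
  (a ∈ X ∧ b ∉ X ∧ ∃ u ∈ α, X \ {a} ⊆ S.MV u) ∨
  (b ∈ X ∧ a ∉ X ∧ ∃ u ∈ β, X \ {b} ⊆ S.MV u)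

/-- A branch-vertex of a tree: a vertex of degree different from two. -/
def BranchVertex (T : SimpleGraph U) (u : U) : Prop := (T.neighborSet u).ncard ≠ 2

/-- `u` and `v` are distinct branch-vertices joined by a branch of `T`. -/
def JoinedByBranch (T : SimpleGraph U) (u v : U) : Prop :=
  u ≠ v ∧ BranchVertex T u ∧ BranchVertex T v ∧
    ∃ p : T.Walk u v, p.IsPath ∧
      ∀ w ∈ p.support, w ≠ u → w ≠ v → (T.neighborSet w).ncard = 2

/-- The shape of a tree `T`: the graph on its branch-vertices, two being
adjacent when joined by a branch. -/
def Shape (T : SimpleGraph U) : SimpleGraph {u : U // BranchVertex T u} :=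
  SimpleGraph.fromRel (fun u v => JoinedByBranch T u.1 v.1)

/-- `y` is reachable from `x` in `T` by a walk avoiding `v`. -/
def ReachAvoiding (T : SimpleGraph U) (v x y : U) : Prop :=
  ∃ p : T.Walk x y, v ∉ p.support

/-- The component of `x` in `T` minus `v` contains no vertex of `A`. -/
def MissesSet (T : SimpleGraph U) (v : U) (A : Set U) (x : U) : Prop :=
  ∀ z : U, ReachAvoiding T v x z → z ∉ A

/-- `G` contains an induced extended tree line-graph `H(T)` with cross-edge
`ab`, via the injection `φ` of the edges of `T` into `V(G)`, where `(A',B')`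
is the bipartition of the tree `T`. -/
def ExtTreeLineGraphIn (G : SimpleGraph V) (T : SimpleGraph U)
    (A' B' : Set U) (a b : V) (φ : Sym2 U → V) : Prop :=
  T.IsTree ∧
  A' ∪ B' = Set.univ ∧ Disjoint A' B' ∧
  (∀ u v : U, T.Adj u v → (u ∈ A' ↔ v ∈ B')) ∧
  3 ≤ {u : U | IsLeaf T u}.ncard ∧
  (∀ v x y : U, x ≠ v → y ≠ v → MissesSet T v A' x → MissesSet T v A' y →
    ReachAvoiding T v x y) ∧
  (∀ v x y : U, x ≠ v → y ≠ v → MissesSet T v B' x → MissesSet T v B' y →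
    ReachAvoiding T v x y) ∧
  G.Adj a b ∧
  Set.InjOn φ T.edgeSet ∧
  (∀ e ∈ T.edgeSet, φ e ≠ a ∧ φ e ≠ b) ∧
  (∀ e ∈ T.edgeSet, ∀ f ∈ T.edgeSet, e ≠ f →
    (G.Adj (φ e) (φ f) ↔ ∃ u : U, u ∈ e ∧ u ∈ f)) ∧
  (∀ e ∈ T.edgeSet, (G.Adj a (φ e) ↔ ∃ u : U, u ∈ e ∧ IsLeaf T u ∧ u ∈ A')) ∧
  (∀ e ∈ T.edgeSet, (G.Adj b (φ e) ↔ ∃ u : U, u ∈ e ∧ IsLeaf T u ∧ u ∈ B'))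

/-- `(J, M)` is optimal for the edge `ab`: `G` contains an induced extended tree
line-graph with cross-edge `ab`; among all such, the shape `J` has as many edges
as possible; and the `J`-strip system `S` has cross-edge `ab` with partition
`(α,β)` and `V(M)` maximal. -/
def OptimalFor {G : SimpleGraph V} {J : SimpleGraph W} (S : StripSystem G J)
    (a b : V) (α β : Set W) : Prop :=
  (∃ (n : ℕ) (T : SimpleGraph (Fin n)) (A' B' : Set (Fin n)) (φ : Sym2 (Fin n) → V),
      ExtTreeLineGraphIn G T A' B' a b φ ∧ Nonempty (J ≃g Shape T)) ∧
  (∀ (n : ℕ) (T : SimpleGraph (Fin n)) (A' B' : Set (Fin n)) (φ : Sym2 (Fin n) → V),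
      ExtTreeLineGraphIn G T A' B' a b φ →
      (Shape T).edgeSet.ncard ≤ J.edgeSet.ncard) ∧
  IsCrossEdge S a b α β ∧
  (∀ (S' : StripSystem G J) (α' β' : Set W), IsCrossEdge S' a b α' β' →
      VM S ⊆ VM S' → VM S' = VM S)

/-- There is a path from `y` to `VMset \ N[a]` containing no neighbours of `a`
except `y`. -/
def ExternalFrom (G : SimpleGraph V) (VMset : Set V) (a y : V) : Prop :=
  ∃ (z : V) (P : G.Walk y z), P.IsPath ∧ z ∈ VMset ∧ z ∉ closedNbhd G a ∧
    ∀ v ∈ P.support, G.Adj a v → v = y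

/-- A major vertex: a common neighbour of `a,b` that is both `a`-external and
`b`-external. -/
def MajorVertex {G : SimpleGraph V} {J : SimpleGraph W} (S : StripSystem G J)
    (a b : V) (y : V) : Prop :=
  G.Adj a y ∧ G.Adj b y ∧ ExternalFrom G (VM S) a y ∧ ExternalFrom G (VM S) b y

/-- The vertex set of a pyramid strip system. -/
def PSSVerts (a : V) {k : ℕ} (A B C : Fin k → Set V) : Set V :=
  insert a (⋃ i, A i ∪ B i ∪ C i)

/-- A pyramid strip system with apex `a` and proper strips `(A i, B i, C i)`. -/
def IsPyramidStripSystem (G : SimpleGraph V) (a : V) {k : ℕ}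
    (A B C : Fin k → Set V) : Prop :=
  3 ≤ k ∧
  (∀ i, IsStrip G (A i) (B i) (C i)) ∧
  (∀ i, Disjoint (A i) (B i)) ∧
  (∀ i j, i ≠ j → Disjoint (A i ∪ B i ∪ C i) (A j ∪ B j ∪ C j)) ∧
  (∀ i j, i ≠ j → ∀ p ∈ A i ∪ B i ∪ C i, ∀ q ∈ A j ∪ B j ∪ C j,
      (G.Adj p q ↔ p ∈ B i ∧ q ∈ B j)) ∧
  (∀ i, a ∉ A i ∪ B i ∪ C i) ∧
  (∀ i, ∀ p ∈ A i ∪ B i ∪ C i, (G.Adj a p ↔ p ∈ A i))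

/-- `D i`: the union of the vertex sets of all components `F` of
`G \ (V(𝒮) ∪ N[a])` having a neighbour in `A i ∪ C i`. -/
def PSSD (G : SimpleGraph V) (a : V) {k : ℕ} (A B C : Fin k → Set V)
    (i : Fin k) : Set V :=
  ⋃₀ {F : Set V | IsComponentOf G (PSSVerts a A B C ∪ closedNbhd G a) F ∧
      ∃ v ∈ A i ∪ C i, ∃ x ∈ F, G.Adj v x}

def TypeAlpha (G : SimpleGraph V) {k : ℕ} (A B C : Fin k → Set V) (v : V) : Prop :=
  ∀ i : Fin k, (∃ p ∈ B i ∪ C i, G.Adj v p) ∨ ∀ p ∈ A i, G.Adj v p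

def TypeAlpha' (G : SimpleGraph V) (a : V) {k : ℕ} (A B C : Fin k → Set V)
    (v : V) : Prop :=
  ∃ i : Fin k, (∃ x ∈ PSSD G a A B C i, G.Adj v x) ∧
    (∀ p ∈ B i ∪ C i, ¬ G.Adj v p) ∧
    ∀ j : Fin k, j ≠ i →
      (∀ p ∈ A j, G.Adj v p) ∧ ∀ p ∈ B j ∪ C j ∪ PSSD G a A B C j, ¬ G.Adj v p

def TypeBeta (G : SimpleGraph V) {k : ℕ} (A B C : Fin k → Set V) (v : V) : Prop :=
  ∃ i : Fin k, (∀ p ∈ A i ∪ B i ∪ C i, ¬ G.Adj v p) ∧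
    ∀ j : Fin k, j ≠ i → ∃ p ∈ B j ∪ C j, G.Adj v p

def TypeGamma (G : SimpleGraph V) (a : V) {k : ℕ} (A B C : Fin k → Set V)
    (v : V) : Prop :=
  ∃ (i : Fin k) (q : V) (Q : G.Walk v q), Q.IsPath ∧ InducedWalk G Q ∧
    (∀ w ∈ Q.support, w ≠ v → w ∉ PSSVerts a A B C ∪ closedNbhd G a) ∧
    (∃ p ∈ ⋃ j, B j, G.Adj q p) ∧
    ((∀ p ∈ (⋃ j, B j) \ B i, G.Adj q p) ∨ ∀ p ∈ (⋃ j, B j) \ B i, ¬ G.Adj q p) ∧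
    (∀ j : Fin k, j ≠ i → ∀ p ∈ A j, G.Adj v p) ∧
    (∀ j : Fin k, ∀ p ∈ B j ∪ C j ∪ PSSD G a A B C j, ¬ G.Adj v p) ∧
    ∀ w ∈ Q.support, w ≠ v → ∀ p ∈ PSSVerts a A B C, G.Adj w p →
      w = q ∧ p ∈ ⋃ j, B j

/-- A backdoor for `z`, relative to the strip `(A,B,C)` and the set `D`. -/
def Backdoor (G : SimpleGraph V) (A B C D : Set V) (z : V) : Prop :=
  ∃ (b' : V) (R : G.Walk z b'), R.IsPath ∧ InducedWalk G R ∧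
    (∀ w ∈ R.support, w ≠ z → w ≠ b' → ∀ p ∈ (A ∪ B ∪ C) ∪ D, ¬ G.Adj w p) ∧
    (∀ p ∈ B, G.Adj b' p) ∧ ∀ p ∈ A ∪ C ∪ D, ¬ G.Adj b' p

/-- The walk visiting `g 0, g 1, …, g n` in this order. -/
def walkOfFun (G : SimpleGraph V) (g : ℕ → V) (hg : ∀ i, G.Adj (g i) (g (i + 1))) :
    (n : ℕ) → G.Walk (g 0) (g n)
  | 0 => .nil
  | n + 1 => (walkOfFun G g hg n).concat (hg n)

theorem support_walkOfFun (G : SimpleGraph V) (g : ℕ → V) (hg : ∀ i, G.Adj (g i) (g (i + 1)))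
    (n : ℕ) : (walkOfFun G g hg n).support = (List.range (n + 1)).map g := by
  induction n with
  | zero => simp [walkOfFun]
  | succ n ih =>
    rw [walkOfFun, Walk.support_concat, ih, List.range_succ (n := n + 1)]
    simp

theorem edges_walkOfFun (G : SimpleGraph V) (g : ℕ → V) (hg : ∀ i, G.Adj (g i) (g (i + 1)))
    (n : ℕ) : (walkOfFun G g hg n).edges = (List.range n).map fun i => s(g i, g (i + 1)) := by
  induction n with
  | zero => simp [walkOfFun]
  | succ n ih =>
    rw [walkOfFun, Walk.edges_concat, ih, List.range_succ]
    simp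

theorem length_walkOfFun (G : SimpleGraph V) (g : ℕ → V) (hg : ∀ i, G.Adj (g i) (g (i + 1)))
    (n : ℕ) : (walkOfFun G g hg n).length = n := by
  induction n with
  | zero => rfl
  | succ n ih => rw [walkOfFun, Walk.length_concat, ih]

theorem isPath_walkOfFun (G : SimpleGraph V) (g : ℕ → V) (hg : ∀ i, G.Adj (g i) (g (i + 1)))
    (n : ℕ) (hinj : ∀ i j, i < j → j ≤ n → g i ≠ g j) : (walkOfFun G g hg n).IsPath := by
  rw [Walk.isPath_def, support_walkOfFun]
  refine List.Nodup.map_on ?_ List.nodup_range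
  intro x hx y hy hxy
  simp only [List.mem_range] at hx hy
  rcases lt_trichotomy x y with h | h | h
  · exact absurd hxy (hinj x y h (by omega))
  · exact h
  · exact absurd hxy.symm (hinj y x h (by omega))

/-- `h`, of period `N`, goes around an induced cycle of length `N ≥ 4`. -/
structure IsCyc (G : SimpleGraph V) (N : ℤ) (h : ℤ → V) : Prop where
  four : 4 ≤ N
  per : ∀ i, h (i + N) = h i
  adj : ∀ i, G.Adj (h i) (h (i + 1))
  nadj : ∀ i j, i + 2 ≤ j → j + 2 ≤ i + N → ¬ G.Adj (h i) (h j)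
  inj : ∀ i j, i < j → j < i + N → h i ≠ h j

theorem IsCyc.of_adj {G : SimpleGraph V} {N : ℤ} {h : ℤ → V} (H : IsCyc G N h) {i j : ℤ}
    (hadj : G.Adj (h i) (h j)) : j ≤ i + 1 ∨ i + N ≤ j + 1 := by
  by_contra hcon
  exact H.nadj i j (by omega) (by omega) hadj

theorem IsCyc.odd {G : SimpleGraph V} (hG : EvenHoleFree G) {N : ℤ} {h : ℤ → V}
    (H : IsCyc G N h) : N % 2 = 1 := by
  obtain ⟨n, rfl⟩ : ∃ n : ℕ, N = n + 1 := ⟨(N - 1).toNat, by have := H.four; omega⟩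
  have h4 := H.four
  let g : ℕ → V := fun i => h i
  have hg : ∀ i, G.Adj (g i) (g (i + 1)) := fun i => by
    have := H.adj i
    simpa [g] using this
  have hclose : G.Adj (g n) (g 0) := by
    have := H.adj n
    have h0 := H.per 0
    simp only [zero_add] at h0
    simpa [g, h0] using this
  let c : G.Walk (g n) (g n) := .cons hclose (walkOfFun G g hg n)
  have hlen : c.length = n + 1 := by simp [c, length_walkOfFun]
  have hsupp : ∀ x, x ∈ c.support → ∃ i : ℕ, i ≤ n ∧ g i = x := by
    intro x hx
    simp only [c, Walk.support_cons, List.mem_cons, support_walkOfFun, List.mem_map,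
      List.mem_range] at hx
    rcases hx with rfl | ⟨i, hi, rfl⟩
    · exact ⟨n, le_rfl, rfl⟩
    · exact ⟨i, by omega, rfl⟩
  have hne : ∀ i j : ℕ, i < j → j ≤ n → g i ≠ g j := fun i j hij hj =>
    H.inj i j (by omega) (by omega)
  have hedge : ∀ i j : ℕ, i < j → j ≤ n → G.Adj (g i) (g j) → s(g i, g j) ∈ c.edges := by
    intro i j hij hj hadj
    have hcases : j = i + 1 ∨ (i = 0 ∧ j = n) := by
      by_contra hcon
      exact H.nadj i j (by omega) (by omega) hadj
    simp only [c, Walk.edges_cons, List.mem_cons, edges_walkOfFun, List.mem_map, List.mem_range]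
    rcases hcases with rfl | ⟨rfl, rfl⟩
    · exact .inr ⟨i, by omega, rfl⟩
    · exact .inl Sym2.eq_swap
  have hhole : IsHole G c := by
    refine ⟨?_, by omega, ?_⟩
    · rw [Walk.cons_isCycle_iff]
      refine ⟨isPath_walkOfFun G g hg n hne, ?_⟩
      rw [edges_walkOfFun]
      simp only [List.mem_map, List.mem_range, not_exists, not_and]
      intro i hi heq
      rw [Sym2.eq_iff] at heq
      rcases heq with ⟨h1, -⟩ | ⟨h1, h2⟩
      · exact hne i n hi le_rfl h1
      · have hi0 : i = 0 := by
          by_contra h0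
          exact hne 0 i (by omega) (by omega) h1.symm
        subst hi0
        exact hne 1 n (by omega) le_rfl h2
    · intro x y hx hy hxy
      obtain ⟨i, hi, rfl⟩ := hsupp x hx
      obtain ⟨j, hj, rfl⟩ := hsupp y hy
      rcases lt_trichotomy i j with hij | rfl | hij
      · exact hedge i j hij hj hxy
      · exact absurd hxy (G.loopless.irrefl _)
      · rw [Sym2.eq_swap]
        exact hedge j i hij hi hxy.symm
  have := hG _ c hhole
  rw [hlen, Nat.even_iff] at this
  omega

theorem IsCyc.of_seq {G : SimpleGraph V} {M : ℤ} (hM : 4 ≤ M) {f : ℤ → V}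
    (hf : ∀ s t, 0 ≤ s → s < t → t < M →
      f s ≠ f t ∧ (G.Adj (f s) (f t) ↔ t = s + 1 ∨ (s = 0 ∧ t = M - 1))) :
    IsCyc G M (fun i => f (i % M)) := by
  have key : ∀ i j, i < j → j < i + M → 0 ≤ i % M ∧ i % M < M ∧
      ((i % M + (j - i) < M ∧ j % M = i % M + (j - i)) ∨
        (M ≤ i % M + (j - i) ∧ j % M = i % M + (j - i) - M)) := by
    intro i j h1 h2
    have hr := Int.emod_nonneg i (show M ≠ 0 by omega)
    have hr' := Int.emod_lt_of_pos i (show 0 < M by omega)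
    refine ⟨hr, hr', ?_⟩
    have hj : j % M = (i % M + (j - i)) % M := by
      rw [Int.emod_add_emod]; congr 1; ring
    rcases lt_or_ge (i % M + (j - i)) M with hlt | hge
    · exact .inl ⟨hlt, by rw [hj, Int.emod_eq_of_lt (by omega) hlt]⟩
    · refine .inr ⟨hge, ?_⟩
      rw [hj, ← Int.sub_emod_right, Int.emod_eq_of_lt (by omega) (by omega)]
  refine ⟨hM, fun i => by simp, fun i => ?_, fun i j h1 h2 => ?_, fun i j h1 h2 => ?_⟩
  · obtain ⟨hr, hr', ⟨h3, h4⟩ | ⟨h3, h4⟩⟩ := key i (i + 1) (by omega) (by omega)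
    · exact (hf _ _ hr (by omega) (by omega)).2.2 (.inl (by omega))
    · exact ((hf _ _ (by omega) (by omega) hr').2.2 (.inr ⟨by omega, by omega⟩)).symm
  · obtain ⟨hr, hr', ⟨h3, h4⟩ | ⟨h3, h4⟩⟩ := key i j (by omega) (by omega)
    · intro h
      have := (hf _ _ hr (by omega) (by omega)).2.1 h
      omega
    · intro h
      have := (hf _ _ (by omega) (by omega) hr').2.1 h.symm
      omega
  · obtain ⟨hr, hr', ⟨h3, h4⟩ | ⟨h3, h4⟩⟩ := key i j (by omega) (by omega)
    · exact (hf _ _ hr (by omega) (by omega)).1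
    · exact (hf _ _ (by omega) (by omega) hr').1.symm

/-- `f 0, …, f (m - 1)` is an induced path. -/
def IndPath (G : SimpleGraph V) (m : ℤ) (f : ℤ → V) : Prop :=
  ∀ s t, 0 ≤ s → s < t → t < m → f s ≠ f t ∧ (G.Adj (f s) (f t) ↔ t = s + 1)

/-- The sequence `f 0, …, f (m - 1), g 0, g 1, …`. -/
def append (m : ℤ) (f g : ℤ → V) : ℤ → V := fun t => if t < m then f t else g (t - m)

theorem IndPath.append {G : SimpleGraph V} {m m' : ℤ} {f g : ℤ → V}
    (hf : IndPath G m f) (hg : IndPath G m' g)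
    (hfg : ∀ s t, 0 ≤ s → s < m → 0 ≤ t → t < m' →
      f s ≠ g t ∧ (G.Adj (f s) (g t) ↔ s = m - 1 ∧ t = 0)) :
    IndPath G (m + m') (append m f g) := by
  intro s t hs hst ht
  unfold EHF.append
  by_cases h1 : t < m
  · rw [if_pos h1, if_pos (by omega)]
    exact hf s t hs hst h1
  · by_cases h2 : s < m
    · rw [if_neg h1, if_pos h2]
      obtain ⟨h3, h4⟩ := hfg s (t - m) hs h2 (by omega) (by omega)
      refine ⟨h3, h4.trans ?_⟩
      omega
    · rw [if_neg h1, if_neg h2]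
      obtain ⟨h3, h4⟩ := hg (s - m) (t - m) (by omega) (by omega) (by omega)
      refine ⟨h3, h4.trans ?_⟩
      omega

theorem IsCyc.of_indPaths {G : SimpleGraph V} {m m' : ℤ} {f g : ℤ → V}
    (hf : IndPath G m f) (hg : IndPath G m' g) (hm : 1 ≤ m) (hm' : 1 ≤ m') (h4 : 4 ≤ m + m')
    (hfg : ∀ s t, 0 ≤ s → s < m → 0 ≤ t → t < m' →
      f s ≠ g t ∧ (G.Adj (f s) (g t) ↔ (s = m - 1 ∧ t = 0) ∨ (s = 0 ∧ t = m' - 1))) :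
    IsCyc G (m + m') (fun i => append m f g (i % (m + m'))) := by
  apply IsCyc.of_seq h4
  intro s t hs hst ht
  unfold EHF.append
  by_cases h1 : t < m
  · rw [if_pos h1, if_pos (by omega)]
    obtain ⟨h3, h4⟩ := hf s t hs hst h1
    refine ⟨h3, h4.trans ?_⟩
    omega
  · by_cases h2 : s < m
    · rw [if_neg h1, if_pos h2]
      obtain ⟨h3, h4⟩ := hfg s (t - m) hs h2 (by omega) (by omega)
      refine ⟨h3, h4.trans ?_⟩
      omega
    · rw [if_neg h1, if_neg h2]
      obtain ⟨h3, h4⟩ := hg (s - m) (t - m) (by omega) (by omega) (by omega)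
      refine ⟨h3, h4.trans ?_⟩
      omega

theorem IndPath.odd_of_closed {G : SimpleGraph V} (hG : EvenHoleFree G) {m m' : ℤ} {f g : ℤ → V}
    (hf : IndPath G m f) (hg : IndPath G m' g) (hm : 1 ≤ m) (hm' : 1 ≤ m') (h3 : 3 ≤ m + m')
    (hfg : ∀ s t, 0 ≤ s → s < m → 0 ≤ t → t < m' →
      f s ≠ g t ∧ (G.Adj (f s) (g t) ↔ (s = m - 1 ∧ t = 0) ∨ (s = 0 ∧ t = m' - 1))) :
    (m + m') % 2 = 1 := by
  rcases eq_or_lt_of_le h3 with h | h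
  · omega
  · exact (IsCyc.of_indPaths hf hg hm hm' h hfg).odd hG

/-- The sequence `h e, …, h f` as a function of the distance from `e`. -/
def seg (h : ℤ → V) (e f : ℤ) : ℤ → V := fun t => if e ≤ f then h (e + t) else h (e - t)

theorem seg_eq (h : ℤ → V) (e f t : ℤ) (h0 : 0 ≤ t) (ht : t < max e f - min e f + 1) :
    ∃ q, seg h e f t = h q ∧ min e f ≤ q ∧ q ≤ max e f ∧ (q = e ↔ t = 0) ∧
      (q = f ↔ t = max e f - min e f + 1 - 1) := by
  unfold seg
  split_ifs with hef
  · exact ⟨e + t, rfl, by omega, by omega, by omega, by omega⟩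
  · exact ⟨e - t, rfl, by omega, by omega, by omega, by omega⟩

theorem IsCyc.indPath_seg {G : SimpleGraph V} {N : ℤ} {h : ℤ → V} (H : IsCyc G N h) {e f : ℤ}
    (hef : max e f - min e f ≤ N - 2) : IndPath G (max e f - min e f + 1) (seg h e f) := by
  intro s t hs hst ht
  have hadj : ∀ q q' : ℤ, q < q' → q' ≤ q + (N - 2) → (G.Adj (h q) (h q') ↔ q' = q + 1) := by
    intro q q' h1 h2
    constructor
    · intro h3
      by_contra h4
      exact H.nadj q q' (by omega) (by omega) h3
    · rintro rfl
      exact H.adj q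
  unfold seg
  split_ifs with h1
  · refine ⟨H.inj _ _ (by omega) (by omega), (hadj _ _ (by omega) (by omega)).trans ?_⟩
    omega
  · refine ⟨(H.inj _ _ (by omega) (by omega)).symm, ?_⟩
    rw [G.adj_comm, hadj _ _ (by omega) (by omega)]
    omega

theorem IsCyc.arc_parity {G : SimpleGraph V} (hG : EvenHoleFree G) {N : ℤ} {h p : ℤ → V}
    (H : IsCyc G N h) {i j e f : ℤ} (hij : i ≤ j) (hef : max e f - min e f ≤ N - 2)
    (hne : e ≠ f ∨ i ≠ j)
    (hp : ∀ k l, i ≤ k → k < l → l ≤ j → p k ≠ p l ∧ (G.Adj (p k) (p l) ↔ l = k + 1))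
    (hph : ∀ k q, i ≤ k → k ≤ j → p k ≠ h q)
    (h1 : G.Adj (p i) (h e)) (h2 : G.Adj (p j) (h f))
    (h3 : ∀ k q, i ≤ k → k ≤ j → min e f ≤ q → q ≤ max e f → G.Adj (p k) (h q) →
      (k = i ∧ q = e) ∨ (k = j ∧ q = f)) :
    (e + f + i + j) % 2 = 1 := by
  have hP : IndPath G (j - i + 1) (fun t => p (i + t)) := by
    intro s t hs hst ht
    obtain ⟨h4, h5⟩ := hp (i + s) (i + t) (by omega) (by omega) (by omega)
    exact ⟨h4, h5.trans (by omega)⟩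
  have := hP.odd_of_closed hG (H.indPath_seg (e := f) (f := e) (by omega)) (by omega) (by omega)
    (by omega) ?_
  · omega
  intro s t hs hs' ht ht'
  obtain ⟨q, hq, q1, q2, q3, q4⟩ := seg_eq h f e t ht ht'
  rw [hq]
  refine ⟨hph _ _ (by omega) (by omega), fun h => ?_, ?_⟩
  · have := h3 (i + s) q (by omega) (by omega) (by omega) (by omega) h
    omega
  · rintro (⟨h5, h6⟩ | ⟨h5, h6⟩)
    · rw [q3.2 h6, show i + s = j by omega]
      exact h2
    · rw [q4.2 h6, show i + s = i by omega]
      exact h1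

theorem IsCyc.apex_arc_parity {G : SimpleGraph V} (hG : EvenHoleFree G) {N : ℤ} {h p : ℤ → V}
    (H : IsCyc G N h) {a : V} {i j e₁ f₁ e₂ f₂ : ℤ} (hij : i ≤ j)
    (hsep : max e₁ f₁ + 2 ≤ min e₂ f₂) (hsep' : max e₂ f₂ + 2 ≤ min e₁ f₁ + N)
    (hp : ∀ k l, i ≤ k → k < l → l ≤ j → p k ≠ p l ∧ (G.Adj (p k) (p l) ↔ l = k + 1))
    (hph : ∀ k q, i ≤ k → k ≤ j → p k ≠ h q)
    (hap : ∀ k, i ≤ k → k ≤ j → a ≠ p k ∧ ¬ G.Adj a (p k))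
    (hah : ∀ q, a ≠ h q)
    (ha₁ : G.Adj a (h e₁)) (ha₂ : G.Adj a (h e₂))
    (hp₁ : G.Adj (p i) (h f₁)) (hp₂ : G.Adj (p j) (h f₂))
    (ha₁' : ∀ q, min e₁ f₁ ≤ q → q ≤ max e₁ f₁ → G.Adj a (h q) → q = e₁)
    (ha₂' : ∀ q, min e₂ f₂ ≤ q → q ≤ max e₂ f₂ → G.Adj a (h q) → q = e₂)
    (hp₁' : ∀ k q, i ≤ k → k ≤ j → min e₁ f₁ ≤ q → q ≤ max e₁ f₁ → G.Adj (p k) (h q) →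
      k = i ∧ q = f₁)
    (hp₂' : ∀ k q, i ≤ k → k ≤ j → min e₂ f₂ ≤ q → q ≤ max e₂ f₂ → G.Adj (p k) (h q) →
      k = j ∧ q = f₂) :
    (e₁ + f₁ + e₂ + f₂ + i + j) % 2 = 1 := by
  have hP : IndPath G (j - i + 1) (fun t => p (i + t)) := by
    intro s t hs hst ht
    obtain ⟨h4, h5⟩ := hp (i + s) (i + t) (by omega) (by omega) (by omega)
    exact ⟨h4, h5.trans (by omega)⟩
  have hA : IndPath G 1 (fun _ => a) := fun s t _ _ _ => by omega
  have hPB : IndPath G (j - i + 1 + (max f₂ e₂ - min f₂ e₂ + 1))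
      (EHF.append (j - i + 1) (fun t => p (i + t)) (seg h f₂ e₂)) := by
    refine hP.append (H.indPath_seg (by omega)) ?_
    intro s t hs hs' ht ht'
    obtain ⟨q, hq, q1, q2, q3, q4⟩ := seg_eq h f₂ e₂ t ht ht'
    rw [hq]
    refine ⟨hph _ _ (by omega) (by omega), fun h => ?_, ?_⟩
    · have := hp₂' (i + s) q (by omega) (by omega) (by omega) (by omega) h
      omega
    · rintro ⟨h5, h6⟩
      rw [q3.2 h6, show i + s = j by omega]
      exact hp₂
  have hAPB : IndPath G (max e₁ f₁ - min e₁ f₁ + 1 + (j - i + 1 + (max f₂ e₂ - min f₂ e₂ + 1)))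
      (EHF.append (max e₁ f₁ - min e₁ f₁ + 1) (seg h e₁ f₁)
        (EHF.append (j - i + 1) (fun t => p (i + t)) (seg h f₂ e₂))) := by
    refine (H.indPath_seg (by omega)).append hPB ?_
    intro s t hs hs' ht ht'
    obtain ⟨q, hq, q1, q2, q3, q4⟩ := seg_eq h e₁ f₁ s hs hs'
    rw [hq]
    unfold EHF.append
    split_ifs with h1
    · refine ⟨(hph _ _ (by omega) (by omega)).symm, fun h => ?_, ?_⟩
      · have := hp₁' (i + t) q (by omega) (by omega) (by omega) (by omega) h.symm
        omega
      · rintro ⟨h5, h6⟩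
        rw [q4.2 h5]
        obtain rfl : t = 0 := h6
        simpa using hp₁.symm
    · obtain ⟨r, hr, r1, r2, r3, r4⟩ :=
        seg_eq h f₂ e₂ (t - (j - i + 1)) (by omega) (by omega)
      rw [hr]
      refine ⟨H.inj _ _ (by omega) (by omega), fun h => ?_, by omega⟩
      exact absurd h (H.nadj _ _ (by omega) (by omega))
  have := hAPB.odd_of_closed hG hA (by omega) (by omega) (by omega) ?_
  · omega
  intro s t hs hs' ht ht'
  obtain rfl : t = 0 := by omega
  unfold EHF.append
  split_ifs with h1 h2
  · obtain ⟨q, hq, q1, q2, q3, q4⟩ := seg_eq h e₁ f₁ s hs h1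
    rw [hq]
    refine ⟨(hah _).symm, fun h => ?_, ?_⟩
    · have := ha₁' q q1 q2 h.symm
      omega
    · intro h5
      rw [q3.2 (by omega)]
      exact ha₁.symm
  · obtain ⟨h3, h4⟩ := hap (i + (s - (max e₁ f₁ - min e₁ f₁ + 1))) (by omega) (by omega)
    exact ⟨h3.symm, fun h => absurd h.symm h4, by omega⟩
  · obtain ⟨r, hr, r1, r2, r3, r4⟩ :=
      seg_eq h f₂ e₂ (s - (max e₁ f₁ - min e₁ f₁ + 1) - (j - i + 1)) (by omega) (by omega)
    rw [hr]
    refine ⟨(hah _).symm, fun h => ?_, ?_⟩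
    · have := ha₂' r (by omega) (by omega) h.symm
      omega
    · intro h5
      rw [r4.2 (by omega)]
      exact ha₂.symm

/-- A hole `h` of length `N` with two distinct sectors `[0, ℓ]` and `[b, c]` with respect to `a`,
which are not the two exceptional ones, and an induced path `p 1, …, p n` avoiding `h` and the
closed neighbourhood of `a`, whose first vertex has a neighbour inside `[0, ℓ]` and whose last
vertex has a neighbour inside `[b, c]`. -/
structure Link (G : SimpleGraph V) (a : V) (N ℓ b c n : ℤ) (h p : ℤ → V) : Prop where
  cyc : IsCyc G N h
  two_le : 2 ≤ ℓ
  le_b : ℓ ≤ b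
  lt_c : b + 2 ≤ c
  le_N : c ≤ N
  a0 : G.Adj a (h 0)
  al : G.Adj a (h ℓ)
  ab : G.Adj a (h b)
  ac : G.Adj a (h c)
  sec₁ : ∀ q, G.Adj a (h q) → q ≤ 0 ∨ ℓ ≤ q
  sec₂ : ∀ q, G.Adj a (h q) → q ≤ b ∨ c ≤ q
  ah : ∀ q, a ≠ h q
  exc₁ : ¬ (b = ℓ ∧ c = N - 1)
  exc₂ : ¬ (b = ℓ + 1 ∧ c = N)
  one_le : 1 ≤ n
  pp : ∀ k l, 1 ≤ k → k < l → l ≤ n → p k ≠ p l ∧ (G.Adj (p k) (p l) ↔ l = k + 1)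
  ap : ∀ k, 1 ≤ k → k ≤ n → a ≠ p k ∧ ¬ G.Adj a (p k)
  ph : ∀ k q, 1 ≤ k → k ≤ n → p k ≠ h q
  w₁ : ∃ q, 0 < q ∧ q < ℓ ∧ G.Adj (p 1) (h q)
  w₂ : ∃ q, b < q ∧ q < c ∧ G.Adj (p n) (h q)

namespace Link

variable {G : SimpleGraph V} {a : V} {N ℓ b c n : ℤ} {h p : ℤ → V}

theorem hN (F : Link G a N ℓ b c n h p) : h N = h 0 := by
  simpa using F.cyc.per 0

theorem basic (F : Link G a N ℓ b c n h p) (hG : EvenHoleFree G) :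
    N % 2 = 1 ∧ ℓ % 2 = 1 ∧ (c - b) % 2 = 1 := by
  have := F.two_le
  have := F.le_b
  have := F.lt_c
  have := F.le_N
  refine ⟨F.cyc.odd hG, ?_, ?_⟩
  · have := F.cyc.arc_parity hG (p := fun _ => a) (i := 0) (j := 0) (e := 0) (f := ℓ) le_rfl
      (by omega) (by omega) (by omega) (fun _ q _ _ => F.ah q) F.a0 F.al ?_
    · omega
    · intro k q h1 h2 h3 h4 h5
      have := F.sec₁ q h5
      omega
  · have := F.cyc.arc_parity hG (p := fun _ => a) (i := 0) (j := 0) (e := b) (f := c) le_rfl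
      (by omega) (by omega) (by omega) (fun _ q _ _ => F.ah q) F.ab F.ac ?_
    · omega
    · intro k q h1 h2 h3 h4 h5
      have := F.sec₂ q h5
      omega

theorem arc (F : Link G a N ℓ b c n h p) (hG : EvenHoleFree G) (i j e f : ℤ) (hi : 1 ≤ i)
    (hij : i ≤ j) (hj : j ≤ n) (hef : max e f - min e f ≤ N - 2)
    (hne : e ≠ f ∨ i ≠ j) (h1 : G.Adj (p i) (h e)) (h2 : G.Adj (p j) (h f))
    (h3 : ∀ k q, i ≤ k → k ≤ j → min e f ≤ q → q ≤ max e f → G.Adj (p k) (h q) →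
      (k = i ∧ q = e) ∨ (k = j ∧ q = f)) :
    (e + f + i + j) % 2 = 1 :=
  F.cyc.arc_parity hG hij hef hne
    (fun k l _ _ _ => F.pp k l (by omega) (by omega) (by omega))
    (fun k q _ _ => F.ph k q (by omega) (by omega)) h1 h2 h3

/-- The variant of `Link.arc` for the arc from `e` through `N` to `N + f`. -/
theorem arc_wrap (F : Link G a N ℓ b c n h p) (hG : EvenHoleFree G) (i j e f : ℤ) (hi : 1 ≤ i)
    (hij : i ≤ j) (hj : j ≤ n) (hf : 0 ≤ f) (hef : f + 2 ≤ e) (he : e ≤ N)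
    (hne : e ≠ N + f ∨ i ≠ j) (h1 : G.Adj (p i) (h f)) (h2 : G.Adj (p j) (h e))
    (h3 : ∀ k q, i ≤ k → k ≤ j → 0 ≤ q → q < N → (q ≤ f ∨ e ≤ q) → G.Adj (p k) (h q) →
      (k = i ∧ q = f) ∨ (k = j ∧ (q = e ∨ q = e - N))) :
    (N + e + f + i + j) % 2 = 1 := by
  have := F.arc hG i j (f + N) e hi hij hj (by omega) (by omega)
    (by rw [F.cyc.per]; exact h1) h2 ?_
  · omega
  intro k q hk hk' hq hq' hadj
  rcases lt_or_ge q N with h4 | h4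
  · have := h3 k q hk hk' (by omega) h4 (by omega) hadj
    omega
  · rw [← sub_add_cancel q N, F.cyc.per] at hadj
    have := h3 k (q - N) hk hk' (by omega) (by omega) (by omega) hadj
    omega

theorem apex (F : Link G a N ℓ b c n h p) (hG : EvenHoleFree G) (i j e₁ f₁ e₂ f₂ : ℤ)
    (hi : 1 ≤ i) (hij : i ≤ j) (hj : j ≤ n)
    (hsep : max e₁ f₁ + 2 ≤ min e₂ f₂) (hsep' : max e₂ f₂ + 2 ≤ min e₁ f₁ + N)
    (ha₁ : G.Adj a (h e₁)) (ha₂ : G.Adj a (h e₂))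
    (hp₁ : G.Adj (p i) (h f₁)) (hp₂ : G.Adj (p j) (h f₂))
    (ha₁' : ∀ q, min e₁ f₁ ≤ q → q ≤ max e₁ f₁ → G.Adj a (h q) → q = e₁)
    (ha₂' : ∀ q, min e₂ f₂ ≤ q → q ≤ max e₂ f₂ → G.Adj a (h q) → q = e₂)
    (hp₁' : ∀ k q, i ≤ k → k ≤ j → min e₁ f₁ ≤ q → q ≤ max e₁ f₁ → G.Adj (p k) (h q) →
      k = i ∧ q = f₁)
    (hp₂' : ∀ k q, i ≤ k → k ≤ j → min e₂ f₂ ≤ q → q ≤ max e₂ f₂ → G.Adj (p k) (h q) →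
      k = j ∧ q = f₂) :
    (e₁ + f₁ + e₂ + f₂ + i + j) % 2 = 1 :=
  F.cyc.apex_arc_parity hG hij hsep hsep'
    (fun k l _ _ _ => F.pp k l (by omega) (by omega) (by omega))
    (fun k q _ _ => F.ph k q (by omega) (by omega))
    (fun k _ _ => F.ap k (by omega) (by omega)) F.ah ha₁ ha₂ hp₁ hp₂ ha₁' ha₂' hp₁' hp₂'

theorem common_nbrs (F : Link G a N ℓ b c n h p) (hG : EvenHoleFree G) {k q r : ℤ}
    (hk : 1 ≤ k) (hk' : k ≤ n) (hqr : q + 2 ≤ r) (hrq : r + 2 ≤ q + N)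
    (h1 : G.Adj a (h q)) (h2 : G.Adj a (h r)) (h3 : G.Adj (p k) (h q))
    (h4 : G.Adj (p k) (h r)) : False := by
  have := F.apex hG k k q q r r hk le_rfl hk' (by omega) (by omega) h1 h2 h3 h4
    (fun _ _ _ _ => by omega) (fun _ _ _ _ => by omega) (fun _ _ _ _ _ _ _ => by omega)
    (fun _ _ _ _ _ _ _ => by omega)
  omega

theorem reflect (F : Link G a N ℓ b c n h p) :
    Link G a N ℓ (N + ℓ - c) (N + ℓ - b) n (fun q => h (ℓ - q)) p := by
  have hper : ∀ q, h (q - N) = h q := fun q => by rw [← F.cyc.per (q - N), sub_add_cancel]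
  obtain ⟨cyc, two_le, le_b, lt_c, le_N, a0, al, ab, ac, sec₁, sec₂, ah, exc₁, exc₂, one_le, pp, ap,
    ph, ⟨q₁, w1, w1', w1''⟩, ⟨q₂, w2, w2', w2''⟩⟩ := F
  refine ⟨⟨cyc.four, fun i => ?_, fun i => ?_, fun i j h1 h2 h3 => ?_, fun i j h1 h2 => ?_⟩,
    two_le, by omega, by omega, by omega, by simpa using al, by simpa using a0, ?_, ?_,
    fun q h1 => by have := sec₁ _ h1; omega, fun q h1 => ?_, fun q => ah _, by omega,
    by omega, one_le, pp, ap, fun k q => ph k _, ⟨ℓ - q₁, by omega, by omega, ?_⟩,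
    ⟨N + ℓ - q₂, by omega, by omega, ?_⟩⟩
  · rw [← cyc.per (ℓ - (i + N))]; congr 1; ring
  · have := (cyc.adj (ℓ - (i + 1))).symm
    rwa [show ℓ - (i + 1) + 1 = ℓ - i by ring] at this
  · exact cyc.nadj (ℓ - j) (ℓ - i) (by omega) (by omega) h3.symm
  · exact (cyc.inj (ℓ - j) (ℓ - i) (by omega) (by omega)).symm
  · rw [show ℓ - (N + ℓ - c) = c - N by ring, hper]; exact ac
  · rw [show ℓ - (N + ℓ - b) = b - N by ring, hper]; exact ab
  · rw [show ℓ - q = N + ℓ - q - N by ring, hper] at h1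
    have := sec₂ _ h1
    omega
  · simpa using w1''
  · rw [show ℓ - (N + ℓ - q₂) = q₂ - N by ring, hper]; exact w2''

theorem swap (F : Link G a N ℓ b c n h p) :
    Link G a N (c - b) (N - b) (N + ℓ - b) n (fun q => h (q + b)) (fun k => p (n + 1 - k)) := by
  obtain ⟨cyc, two_le, le_b, lt_c, le_N, a0, al, ab, ac, sec₁, sec₂, ah, exc₁, exc₂, one_le, pp, ap,
    ph, ⟨q₁, w1, w1', w1''⟩, ⟨q₂, w2, w2', w2''⟩⟩ := F
  have hper : ∀ q, h (q - N) = h q := fun q => by rw [← cyc.per (q - N), sub_add_cancel]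
  refine ⟨⟨cyc.four, fun i => ?_, fun i => ?_, fun i j h1 h2 h3 => ?_, fun i j h1 h2 => ?_⟩,
    by omega, by omega, by omega, by omega, by simpa using ab, by simpa using ac, ?_, ?_,
    fun q h1 => by have := sec₂ _ h1; omega, fun q h1 => ?_, fun q => ah _, by omega,
    by omega, one_le, fun k l h1 h2 h3 => ?_, fun k h1 h2 => ap _ (by omega) (by omega),
    fun k q h1 h2 => ph _ _ (by omega) (by omega), ⟨q₂ - b, by omega, by omega, by simpa using w2''⟩,
    ⟨N + q₁ - b, by omega, by omega, ?_⟩⟩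
  · rw [← cyc.per (i + b)]; congr 1; ring
  · have := cyc.adj (i + b)
    rwa [show i + b + 1 = i + 1 + b by ring] at this
  · exact cyc.nadj (i + b) (j + b) (by omega) (by omega) h3
  · exact cyc.inj (i + b) (j + b) (by omega) (by omega)
  · rw [sub_add_cancel, ← hper, sub_self]; exact a0
  · rw [sub_add_cancel, ← hper, add_sub_cancel_left]; exact al
  · rw [← hper] at h1
    have := sec₁ _ h1
    omega
  · obtain ⟨h4, h5⟩ := pp (n + 1 - l) (n + 1 - k) (by omega) (by omega) (by omega)
    exact ⟨h4.symm, (G.adj_comm _ _).trans (h5.trans (by omega))⟩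
  · rw [sub_add_cancel, ← hper, add_sub_cancel_left]; simpa using w1''

end Link

theorem exists_sector {P : ℤ → Prop} {lo hi j : ℤ} (h1 : lo ≤ j) (h2 : j ≤ hi) (hlo : P lo)
    (hhi : P hi) (hj : ¬ P j) :
    ∃ b c, lo ≤ b ∧ b < j ∧ j < c ∧ c ≤ hi ∧ P b ∧ P c ∧ ∀ q, P q → q ≤ b ∨ c ≤ q := by
  obtain ⟨b, ⟨hb, hb'⟩, hbm⟩ := Int.exists_greatest_of_bdd (P := fun q => P q ∧ q ≤ j)
    ⟨j, fun z hz => hz.2⟩ ⟨lo, hlo, h1⟩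
  obtain ⟨c, ⟨hc, hc'⟩, hcm⟩ := Int.exists_least_of_bdd (P := fun q => P q ∧ j ≤ q)
    ⟨j, fun z hz => hz.2⟩ ⟨hi, hhi, h2⟩
  have hbj : b ≠ j := fun h => hj (h ▸ hb)
  have hcj : c ≠ j := fun h => hj (h ▸ hc)
  have := hbm lo ⟨hlo, h1⟩
  have := hcm hi ⟨hhi, h2⟩
  refine ⟨b, c, by omega, by omega, by omega, by omega, hb, hc, fun q h5 => ?_⟩
  have h6 := fun h => hbm q ⟨h5, h⟩
  have h7 := fun h => hcm q ⟨h5, h⟩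
  omega

/-- A link with a shortest possible connecting path. -/
structure MinLink (G : SimpleGraph V) (a : V) (N ℓ b c n : ℤ) (h p : ℤ → V) : Prop
    extends Link G a N ℓ b c n h p where
  min : ∀ N' ℓ' b' c' n' h' p', Link G a N' ℓ' b' c' n' h' p' → n ≤ n'

namespace MinLink

variable {G : SimpleGraph V} {a : V} {N ℓ b c n : ℤ} {h p : ℤ → V}

theorem reflect (F : MinLink G a N ℓ b c n h p) :
    MinLink G a N ℓ (N + ℓ - c) (N + ℓ - b) n (fun q => h (ℓ - q)) p :=
  ⟨F.toLink.reflect, F.min⟩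

theorem swap (F : MinLink G a N ℓ b c n h p) :
    MinLink G a N (c - b) (N - b) (N + ℓ - b) n (fun q => h (q + b)) (fun k => p (n + 1 - k)) :=
  ⟨F.toLink.swap, F.min⟩

theorem eq_last (F : MinLink G a N ℓ b c n h p) {k q : ℤ} (hk : 1 ≤ k) (hk' : k ≤ n)
    (hq : ℓ ≤ q) (hq' : q ≤ N) (h1 : ¬ G.Adj a (h q)) (h2 : G.Adj (p k) (h q)) : k = n := by
  obtain ⟨b', c', h3, h4, h5, h6, h7, h8, h9⟩ := exists_sector (P := fun q => G.Adj a (h q))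
    hq hq' F.al (by rw [F.hN]; exact F.a0) h1
  have := h9 b F.ab
  have := h9 c F.ac
  have := F.sec₂ b' h7
  have := F.sec₂ c' h8
  have := F.le_b
  have := F.lt_c
  have := F.le_N
  have := F.exc₁
  have := F.exc₂
  have := F.min _ _ _ _ k h p ⟨F.cyc, F.two_le, h3, by omega, h6, F.a0, F.al, h7, h8, F.sec₁, h9,
    F.ah, by omega, by omega, hk, fun i j _ _ _ => F.pp i j (by omega) (by omega) (by omega),
    fun i _ _ => F.ap i (by omega) (by omega), fun i q _ _ => F.ph i q (by omega) (by omega),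
    F.w₁, q, h4, h5, h2⟩
  omega

theorem eq_first (F : MinLink G a N ℓ b c n h p) {k q : ℤ} (hk : 1 ≤ k) (hk' : k ≤ n)
    (hq : 0 < q) (hq' : q < ℓ) (h2 : G.Adj (p k) (h q)) : k = 1 := by
  obtain ⟨r, hr, hr', hr''⟩ := F.w₂
  have := F.min _ _ _ _ (n - (k - 1)) h (fun i => p (i + (k - 1))) ⟨F.cyc, F.two_le, F.le_b, F.lt_c,
    F.le_N, F.a0, F.al, F.ab, F.ac, F.sec₁, F.sec₂, F.ah, F.exc₁, F.exc₂, by omega,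
    fun i j _ _ _ => ?_, fun i _ _ => F.ap _ (by omega) (by omega),
    fun i q _ _ => F.ph _ q (by omega) (by omega), ⟨q, hq, hq', by simpa using h2⟩,
    ⟨r, hr, hr', by simpa using hr''⟩⟩
  · omega
  · obtain ⟨h4, h5⟩ := F.pp (i + (k - 1)) (j + (k - 1)) (by omega) (by omega) (by omega)
    exact ⟨h4, h5.trans (by omega)⟩

theorem nbr (F : MinLink G a N ℓ b c n h p) (hn : 2 ≤ n) {k q : ℤ} (hk : 1 ≤ k) (hk' : k ≤ n)
    (hq : 0 ≤ q) (hq' : q ≤ N) (h1 : G.Adj (p k) (h q)) :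
    G.Adj a (h q) ∨ (k = 1 ∧ 0 < q ∧ q < ℓ) ∨ (k = n ∧ b < q ∧ q < c) := by
  have := F.two_le
  have := F.le_b
  have := F.lt_c
  have := F.le_N
  by_contra! hcon
  obtain ⟨h2, h3, h4⟩ := hcon
  have hq0 : q ≠ 0 := by rintro rfl; exact h2 F.a0
  rcases lt_or_ge q ℓ with h5 | h5
  · have := F.eq_first hk hk' (by omega) h5 h1
    omega
  · have hkn := F.eq_last hk hk' h5 hq' h2 h1
    rcases le_or_gt q b with h6 | h6
    · have e : h (q + N - b + b) = h q := by rw [sub_add_cancel, F.cyc.per]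
      have := F.swap.eq_last (k := n + 1 - k) (q := q + N - b) (by omega) (by omega) (by omega)
        (by omega) (by simpa only [e] using h2) (by simpa only [e, sub_sub_cancel] using h1)
      omega
    · have e : h (q - b + b) = h q := by rw [sub_add_cancel]
      have := F.swap.eq_last (k := n + 1 - k) (q := q - b) (by omega) (by omega) (by omega)
        (by omega) (by simpa only [e] using h2) (by simpa only [e, sub_sub_cancel] using h1)
      omega

theorem reroute (F : MinLink G a N ℓ b c n h p) {j u v : ℤ} (hj : 1 ≤ j) (hjn : j < n)
    (hu : 0 ≤ u) (huv : u + 2 ≤ v) (hv : v ≤ ℓ) (h1 : G.Adj (p 1) (h v)) (h2 : G.Adj (p j) (h u))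
    (h3 : ∀ k q, 1 ≤ k → k ≤ j → 0 ≤ q → q < N → (q ≤ u ∨ v ≤ q) → G.Adj (p k) (h q) →
      (k = 1 ∧ q = v) ∨ (k = j ∧ q = u)) : False := by
  have := F.two_le
  have := F.le_b
  have := F.lt_c
  have := F.le_N
  obtain ⟨M, hM⟩ : ∃ M, M = N + u - v + 1 + j := ⟨_, rfl⟩
  obtain ⟨m, hm⟩ : ∃ m, m = N + u - v + 1 := ⟨_, rfl⟩
  let g : ℤ → V := fun s => h (v + s)
  let g' : ℤ → V := fun t => p (j - t)
  have h3' : ∀ k q, 1 ≤ k → k ≤ j → v ≤ q → q ≤ N + u → G.Adj (p k) (h q) →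
      (k = 1 ∧ q = v) ∨ (k = j ∧ q = N + u) := by
    intro k q hk hk' hq hq' hadj
    rcases lt_or_ge q N with h4 | h4
    · have := h3 k q hk hk' (by omega) h4 (by omega) hadj
      omega
    · rw [← sub_add_cancel q N, F.cyc.per] at hadj
      have := h3 k (q - N) hk hk' (by omega) (by omega) (by omega) hadj
      omega
  have C : IsCyc G (m + j) (fun i => append m g g' (i % (m + j))) := by
    refine IsCyc.of_indPaths ?_ ?_ (by omega) hj (by omega) ?_
    · intro s t hs hst ht
      refine ⟨F.cyc.inj _ _ (by omega) (by omega), fun h4 => ?_, ?_⟩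
      · have := F.cyc.of_adj h4
        omega
      · rintro rfl
        have := F.cyc.adj (v + s)
        rwa [add_assoc] at this
    · intro s t hs hst ht
      obtain ⟨h4, h5⟩ := F.pp (j - t) (j - s) (by omega) (by omega) (by omega)
      exact ⟨h4.symm, (G.adj_comm _ _).trans (h5.trans (by omega))⟩
    · intro s t hs hs' ht ht'
      refine ⟨(F.ph _ _ (by omega) (by omega)).symm, fun h4 => ?_, ?_⟩
      · have := h3' (j - t) (v + s) (by omega) (by omega) (by omega) (by omega) h4.symm
        omega
      · rintro (⟨h4, h5⟩ | ⟨h4, h5⟩)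
        · simp only [g, g', h5, show v + s = u + N by omega, sub_zero, F.cyc.per]
          exact h2.symm
        · simp only [g, g', h4, show j - t = 1 by omega, add_zero]
          exact h1.symm
  rw [← hm] at hM
  rw [← hM] at C
  let k : ℤ → V := fun i => append m g g' ((i + N - v) % M)
  have hk₁ : ∀ q, v - N ≤ q → q ≤ u → k q = h q := by
    intro q h4 h5
    simp only [k, append]
    rw [Int.emod_eq_of_lt (by omega) (by omega), if_pos (by omega)]
    simp only [g]
    rw [← F.cyc.per q]
    congr 1
    ring
  have hk₂ : ∀ q, u < q → q ≤ u + j → k q = p (j + 1 - (q - u)) := by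
    intro q h4 h5
    simp only [k, append]
    rw [Int.emod_eq_of_lt (by omega) (by omega), if_neg (by omega)]
    simp only [g']
    congr 1
    omega
  have kper : ∀ q, k (q + M) = k q := by
    intro q
    have := C.per (q + N - v)
    simp only [k]
    rwa [show q + M + N - v = q + N - v + M by ring]
  have hk₃ : ∀ q, v ≤ q → q ≤ N + u → k (q + (M - N)) = h q := by
    intro q h4 h5
    rw [show q + (M - N) = q - N + M by ring, kper, hk₁ _ (by omega) (by omega),
      ← F.cyc.per (q - N), sub_add_cancel]
  have hk₄ : ∀ q, (∃ r, k q = h r) ∨ (∃ r, 1 ≤ r ∧ r ≤ j ∧ k q = p r) := by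
    intro q
    have h5 := Int.emod_nonneg (q + N - v) (show M ≠ 0 by omega)
    have h6 := Int.emod_lt_of_pos (q + N - v) (show 0 < M by omega)
    simp only [k, append]
    split_ifs with h4
    · exact .inl ⟨_, rfl⟩
    · exact .inr ⟨j - ((q + N - v) % M - m), by omega, by omega, rfl⟩
  have hC : IsCyc G M k := by
    refine ⟨C.four, kper, fun i => ?_, fun i j h1 h2 => C.nadj _ _ (by omega) (by omega),
      fun i j h1 h2 => C.inj _ _ (by omega) (by omega)⟩
    have := C.adj (i + N - v)
    rwa [show i + N - v + 1 = i + 1 + N - v by ring] at this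
  obtain ⟨r, hr, hr', hr''⟩ := F.w₂
  have := F.exc₁
  have := F.exc₂
  have := F.min M (ℓ + (M - N)) (b + (M - N)) (c + (M - N)) (n - j) k (fun i => p (i + j))
    ⟨hC, by omega, by omega, by omega, by omega, ?_, ?_, ?_, ?_, fun q h4 => ?_,
    fun q h4 => ?_, fun q => ?_, by omega, by omega, by omega, fun i j' _ _ _ => ?_,
    fun i _ _ => F.ap _ (by omega) (by omega), fun i q _ _ => ?_, ⟨u + 1, by omega, by omega, ?_⟩,
    ⟨r + (M - N), by omega, by omega, ?_⟩⟩
  · omega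
  · rw [hk₁ 0 (by omega) (by omega)]; exact F.a0
  · rw [hk₃ ℓ (by omega) (by omega)]; exact F.al
  · rw [hk₃ b (by omega) (by omega)]; exact F.ab
  · rw [hk₃ c (by omega) (by omega)]; exact F.ac
  · by_contra! hcon
    rcases le_or_gt q u with h6 | h6
    · rw [hk₁ q (by omega) h6] at h4
      have := F.sec₁ q h4
      omega
    · rcases le_or_gt q (u + j) with h7 | h7
      · rw [hk₂ q h6 h7] at h4
        exact (F.ap _ (by omega) (by omega)).2 h4
      · rw [show q = q - (M - N) + (M - N) by ring, hk₃ _ (by omega) (by omega)] at h4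
        have := F.sec₁ _ h4
        omega
  · by_contra! hcon
    rw [show q = q - (M - N) + (M - N) by ring, hk₃ _ (by omega) (by omega)] at h4
    have := F.sec₂ _ h4
    omega
  · rcases hk₄ q with ⟨r, h4⟩ | ⟨r, h4, h5, h6⟩
    · rw [h4]; exact F.ah r
    · rw [h6]; exact (F.ap r h4 (by omega)).1
  · obtain ⟨h4, h5⟩ := F.pp (i + j) (j' + j) (by omega) (by omega) (by omega)
    exact ⟨h4, h5.trans (by omega)⟩
  · rcases hk₄ q with ⟨r, h4⟩ | ⟨r, h4, h5, h6⟩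
    · rw [h4]; exact F.ph _ r (by omega) (by omega)
    · rw [h6]; exact (F.pp r (i + j) h4 (by omega) (by omega)).1.symm
  · rw [hk₂ _ (by omega) (by omega), show j + 1 - (u + 1 - u) = j by ring, add_comm 1 j]
    exact ((F.pp j (j + 1) hj (by omega) (by omega)).2.2 rfl).symm
  · rw [hk₃ r (by omega) (by omega), sub_add_cancel]
    exact hr''

end MinLink

theorem exists_range {P : ℤ → Prop} {lo hi q : ℤ} (h1 : lo ≤ q) (h2 : q ≤ hi) (h3 : P q) :
    ∃ x y, lo ≤ x ∧ x ≤ q ∧ q ≤ y ∧ y ≤ hi ∧ P x ∧ P y ∧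
      ∀ r, P r → lo ≤ r → r ≤ hi → x ≤ r ∧ r ≤ y := by
  obtain ⟨x, ⟨hx, hx'⟩, hxm⟩ := Int.exists_least_of_bdd (P := fun r => P r ∧ lo ≤ r)
    ⟨lo, fun z hz => hz.2⟩ ⟨q, h3, h1⟩
  obtain ⟨y, ⟨hy, hy'⟩, hym⟩ := Int.exists_greatest_of_bdd (P := fun r => P r ∧ r ≤ hi)
    ⟨hi, fun z hz => hz.2⟩ ⟨q, h3, h2⟩
  exact ⟨x, y, hx', hxm q ⟨h3, h1⟩, hym q ⟨h3, h2⟩, hy', hx, hy,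
    fun r h4 h5 h6 => ⟨hxm r ⟨h4, h5⟩, hym r ⟨h4, h6⟩⟩⟩

namespace Link

variable {G : SimpleGraph V} {a : V} {N ℓ b c n : ℤ} {h p : ℤ → V}

theorem vertex_arc (F : Link G a N ℓ b c n h p) (hG : EvenHoleFree G) {k : ℤ} (hk : 1 ≤ k)
    (hk' : k ≤ n) (e f : ℤ) (hef : e < f) (hfe : f + 2 ≤ e + N) (h1 : G.Adj (p k) (h e))
    (h2 : G.Adj (p k) (h f)) (h3 : ∀ q, e ≤ q → q ≤ f → G.Adj (p k) (h q) → q = e ∨ q = f) :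
    (e + f) % 2 = 1 := by
  have := F.arc hG k k e f hk le_rfl hk' (by omega) (by omega) h1 h2 ?_
  · omega
  intro l q hl hl' hq hq' hadj
  obtain rfl : l = k := by omega
  have := h3 q (by omega) (by omega) hadj
  omega

theorem vertex_arc_wrap (F : Link G a N ℓ b c n h p) (hG : EvenHoleFree G) {k : ℤ} (hk : 1 ≤ k)
    (hk' : k ≤ n) (e f : ℤ) (hf : 0 ≤ f) (hef : f + 2 ≤ e) (he : e ≤ N) (hne : e ≠ N + f)
    (h1 : G.Adj (p k) (h e)) (h2 : G.Adj (p k) (h f))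
    (h3 : ∀ q, 0 ≤ q → q < N → G.Adj (p k) (h q) → f ≤ q ∧ q ≤ e) : (N + e + f) % 2 = 1 := by
  have := F.arc_wrap hG k k e f hk le_rfl hk' hf hef he (by omega) h2 h1 ?_
  · omega
  intro l q hl hl' hq hq' hq'' hadj
  obtain rfl : l = k := by omega
  have := h3 q hq hq' hadj
  omega

theorem vertex_apex (F : Link G a N ℓ b c n h p) (hG : EvenHoleFree G) {k : ℤ} (hk : 1 ≤ k)
    (hk' : k ≤ n) (e₁ f₁ e₂ f₂ : ℤ)
    (hsep : max e₁ f₁ + 2 ≤ min e₂ f₂) (hsep' : max e₂ f₂ + 2 ≤ min e₁ f₁ + N)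
    (ha₁ : G.Adj a (h e₁)) (ha₂ : G.Adj a (h e₂))
    (hp₁ : G.Adj (p k) (h f₁)) (hp₂ : G.Adj (p k) (h f₂))
    (ha₁' : ∀ q, min e₁ f₁ ≤ q → q ≤ max e₁ f₁ → G.Adj a (h q) → q = e₁)
    (ha₂' : ∀ q, min e₂ f₂ ≤ q → q ≤ max e₂ f₂ → G.Adj a (h q) → q = e₂)
    (hp₁' : ∀ q, min e₁ f₁ ≤ q → q ≤ max e₁ f₁ → G.Adj (p k) (h q) → q = f₁)
    (hp₂' : ∀ q, min e₂ f₂ ≤ q → q ≤ max e₂ f₂ → G.Adj (p k) (h q) → q = f₂) :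
    (e₁ + f₁ + e₂ + f₂) % 2 = 1 := by
  have := F.apex hG k k e₁ f₁ e₂ f₂ hk le_rfl hk' hsep hsep' ha₁ ha₂ hp₁ hp₂ ha₁' ha₂' ?_ ?_
  · omega
  · intro l q hl hl' hq hq' hadj
    obtain rfl : l = k := by omega
    exact ⟨rfl, hp₁' q hq hq' hadj⟩
  · intro l q hl hl' hq hq' hadj
    obtain rfl : l = k := by omega
    exact ⟨rfl, hp₂' q hq hq' hadj⟩

set_option maxHeartbeats 1000000 in
theorem vertex_parities (F : Link G a N ℓ b c 1 h p) (hG : EvenHoleFree G)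
    (hc : c = N → ¬ G.Adj (p 1) (h 0)) (hb : b = ℓ → ¬ G.Adj (p 1) (h ℓ)) :
    ∃ x₁ x₂, 0 ≤ x₁ ∧ x₁ < ℓ ∧ b ≤ x₂ ∧ x₂ < c ∧ G.Adj (p 1) (h x₁) ∧ G.Adj (p 1) (h (x₁ + 1)) ∧
      G.Adj (p 1) (h x₂) ∧ G.Adj (p 1) (h (x₂ + 1)) ∧
      (∀ q, G.Adj (p 1) (h q) → 0 ≤ q → q ≤ ℓ → x₁ ≤ q ∧ q ≤ x₁ + 1) ∧
      (∀ q, G.Adj (p 1) (h q) → b ≤ q → q ≤ c → x₂ ≤ q ∧ q ≤ x₂ + 1) ∧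
      (ℓ + x₁ + b + x₂) % 2 = 0 ∧ (x₁ + x₂ + c) % 2 = 0 := by
  obtain ⟨q₁, hq₁, hq₁', hq₁''⟩ := F.w₁
  obtain ⟨q₂, hq₂, hq₂', hq₂''⟩ := F.w₂
  obtain ⟨x₁, y₁, hx₁, hxq₁, hqy₁, hy₁, ax₁, ay₁, m₁⟩ := exists_range
    (P := fun q => G.Adj (p 1) (h q)) hq₁.le hq₁'.le hq₁''
  obtain ⟨x₂, y₂, hx₂, hxq₂, hqy₂, hy₂, ax₂, ay₂, m₂⟩ := exists_range
    (P := fun q => G.Adj (p 1) (h q)) hq₂.le hq₂'.le hq₂''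
  have := F.two_le
  have := F.le_b
  have := F.lt_c
  have := F.le_N
  have := F.basic hG
  have := F.exc₁
  have := F.exc₂
  have z₁ := F.sec₁
  have z₂ := F.sec₂
  have hy₂N : c = N → y₂ ≠ N := by
    rintro hcN rfl
    rw [F.hN] at ay₂
    exact hc hcN ay₂
  have hx₁0 : c = N → x₁ ≠ 0 := by
    rintro hcN rfl
    exact hc hcN ax₁
  have hy₁l : b = ℓ → y₁ ≠ ℓ := by
    rintro hbl rfl
    exact hb hbl ay₁
  have hx₂l : b = ℓ → x₂ ≠ ℓ := by
    rintro hbl rfl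
    exact hb hbl ax₂
  have T₁ : (x₁ + y₁) % 2 = 0 ∨ y₁ ≤ x₁ + 1 := by
    by_contra! hcon
    have := F.vertex_apex hG le_rfl le_rfl 0 x₁ ℓ y₁ (by omega) (by omega) F.a0 F.al ax₁ ay₁
      (fun q _ _ hq => by have := z₁ q hq; omega) (fun q _ _ hq => by have := z₁ q hq; omega)
      (fun q _ _ hq => by have := m₁ q hq; omega) (fun q _ _ hq => by have := m₁ q hq; omega)
    omega
  have T₂ : (x₂ + y₂) % 2 = 0 ∨ y₂ ≤ x₂ + 1 := by
    by_contra! hcon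
    have := F.vertex_apex hG le_rfl le_rfl b x₂ c y₂ (by omega) (by omega) F.ab F.ac ax₂ ay₂
      (fun q _ _ hq => by have := z₂ q hq; omega) (fun q _ _ hq => by have := z₂ q hq; omega)
      (fun q _ _ hq => by have := m₂ q hq; omega) (fun q _ _ hq => by have := m₂ q hq; omega)
    omega
  have R₁ : c ≤ N - 2 → (x₁ + c + y₂) % 2 = 1 := by
    intro hcon
    have := F.vertex_apex hG le_rfl le_rfl 0 x₁ c y₂ (by omega) (by omega) F.a0 F.ac ax₁ ay₂
      (fun q _ _ hq => by have := z₁ q hq; omega) (fun q _ _ hq => by have := z₂ q hq; omega)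
      (fun q _ _ hq => by have := m₁ q hq; omega) (fun q _ _ hq => by have := m₂ q hq; omega)
    omega
  have R₂ : ℓ + 2 ≤ b → (ℓ + y₁ + b + x₂) % 2 = 1 := by
    intro hcon
    exact F.vertex_apex hG le_rfl le_rfl ℓ y₁ b x₂ (by omega) (by omega) F.al F.ab ay₁ ax₂
      (fun q _ _ hq => by have := z₁ q hq; omega) (fun q _ _ hq => by have := z₂ q hq; omega)
      (fun q _ _ hq => by have := m₁ q hq; omega) (fun q _ _ hq => by have := m₂ q hq; omega)
  have R₃ : x₁ + 2 ≤ b → x₂ ≤ N - 2 → (x₁ + b + x₂) % 2 = 1 := by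
    intro hcon hcon'
    have := F.vertex_apex hG le_rfl le_rfl 0 x₁ b x₂ (by omega) (by omega) F.a0 F.ab ax₁ ax₂
      (fun q _ _ hq => by have := z₁ q hq; omega) (fun q _ _ hq => by have := z₂ q hq; omega)
      (fun q _ _ hq => by have := m₁ q hq; omega) (fun q _ _ hq => by have := m₂ q hq; omega)
    omega
  have R₄ : c - y₁ ≤ N - 2 → ℓ + 2 ≤ y₂ → (ℓ + y₁ + c + y₂) % 2 = 1 := by
    intro hcon hcon'
    exact F.vertex_apex hG le_rfl le_rfl ℓ y₁ c y₂ (by omega) (by omega) F.al F.ac ay₁ ay₂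
      (fun q _ _ hq => by have := z₁ q hq; omega) (fun q _ _ hq => by have := z₂ q hq; omega)
      (fun q _ _ hq => by have := m₁ q hq; omega) (fun q _ _ hq => by have := m₂ q hq; omega)
  have S₁ : N - 1 ≤ c → (N + y₂ + x₁) % 2 = 1 := fun hcon =>
    F.vertex_arc_wrap hG le_rfl le_rfl y₂ x₁ (by omega) (by omega) (by omega) (by omega) ay₂ ax₁
      (fun q _ _ hq => by have := m₁ q hq; have := m₂ q hq; omega)
  have S₂ : b ≤ ℓ + 1 → (y₁ + x₂) % 2 = 1 := fun hcon =>
    F.vertex_arc hG le_rfl le_rfl y₁ x₂ (by omega) (by omega) ay₁ ax₂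
      (fun q _ _ hq => by have := m₁ q hq; have := m₂ q hq; omega)
  obtain ⟨rfl, rfl, h1, h2⟩ : y₁ = x₁ + 1 ∧ y₂ = x₂ + 1 ∧ (ℓ + x₁ + b + x₂) % 2 = 0 ∧
      (x₁ + x₂ + c) % 2 = 0 := by
    rcases le_or_gt c (N - 2) with hc₂ | hc₂ <;> rcases le_or_gt (ℓ + 2) b with hb₂ | hb₂
    · have := R₁ hc₂
      have := R₂ hb₂
      have := R₃ (by omega) (by omega)
      have := R₄ (by omega) (by omega)
      clear R₁ R₂ R₃ R₄ S₁ S₂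
      omega
    · have := R₁ hc₂
      have := S₂ (by omega)
      have R₃ := fun h => R₃ h (by omega)
      have R₄ := R₄ (by omega)
      clear R₁ R₂ S₁ S₂
      rcases le_or_gt (x₁ + 2) b with h1 | h1 <;> rcases le_or_gt (ℓ + 2) y₂ with h2 | h2
      · have := R₃ h1; have := R₄ h2; clear R₃ R₄; omega
      · have := R₃ h1; clear R₃ R₄; omega
      · have := R₄ h2; clear R₃ R₄; omega
      · clear R₃ R₄; omega
    · have := R₂ hb₂
      have := S₁ (by omega)
      have R₃ := R₃ (by omega)
      have R₄ := fun h => R₄ h (by omega)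
      clear R₁ R₂ S₁ S₂
      rcases le_or_gt x₂ (N - 2) with h1 | h1 <;> rcases le_or_gt (c - y₁) (N - 2) with h2 | h2
      · have := R₃ h1; have := R₄ h2; clear R₃ R₄; omega
      · have := R₃ h1; clear R₃ R₄; omega
      · have := R₄ h2; clear R₃ R₄; omega
      · clear R₃ R₄; omega
    · clear R₁ R₂ R₃ R₄ S₁ S₂
      omega
  exact ⟨x₁, x₂, hx₁, by omega, hx₂, by omega, ax₁, ay₁, ax₂, ay₂, m₁, m₂, h1, h2⟩

theorem vertex_no_nbr_right (F : Link G a N ℓ b c 1 h p) (hG : EvenHoleFree G)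
    (hc : c = N → ¬ G.Adj (p 1) (h 0)) (hb : b = ℓ → ¬ G.Adj (p 1) (h ℓ)) {q : ℤ} (hq : c < q)
    (hq' : q < N) : ¬ G.Adj (p 1) (h q) := by
  intro hadj
  obtain ⟨x₁, x₂, hx₁, hx₁', hx₂, hx₂', ax₁, ay₁, ax₂, ay₂, m₁, m₂, P₁, P₂⟩ :=
    F.vertex_parities hG hc hb
  have := F.two_le
  have := F.le_b
  have := F.lt_c
  have := F.le_N
  have := F.basic hG
  have z₁ := F.sec₁
  have z₂ := F.sec₂
  by_cases hvc : G.Adj (p 1) (h c)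
  · have hv0 : ¬ G.Adj (p 1) (h 0) := fun h0 =>
      F.common_nbrs hG (q := 0) (r := c) le_rfl le_rfl (by omega) (by omega) F.a0 F.ac h0 hvc
    have hx₁0 : x₁ ≠ 0 := by rintro rfl; exact hv0 ax₁
    obtain ⟨w, ⟨aw, hwN⟩, mw⟩ := Int.exists_greatest_of_bdd
      (P := fun r => G.Adj (p 1) (h r) ∧ r < N) ⟨N, fun z hz => hz.2.le⟩ ⟨q, hadj, hq'⟩
    have hqw := mw q ⟨hadj, hq'⟩
    obtain ⟨z, ⟨az, hwz⟩, mz⟩ := Int.exists_least_of_bdd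
      (P := fun r => G.Adj a (h r) ∧ w ≤ r) ⟨w, fun z hz => hz.2⟩
      ⟨N, by rw [F.hN]; exact F.a0, hwN.le⟩
    have hzN := mz N ⟨by rw [F.hN]; exact F.a0, hwN.le⟩
    have hw' : ∀ r, w ≤ r → r ≤ z → G.Adj (p 1) (h r) → r = w := by
      intro r h1 h2 h3
      by_cases hr : r = N
      · rw [hr, F.hN] at h3
        exact absurd h3 hv0
      · have := mw r ⟨h3, by omega⟩
        omega
    have hvc' := m₂ c hvc (by omega) le_rfl
    have A₁ := F.vertex_apex hG le_rfl le_rfl ℓ (x₁ + 1) z w (by omega) (by omega) F.al az ay₁ aw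
      (fun q _ _ hq => by have := z₁ q hq; omega)
      (fun q _ _ hq => by have := mz q ⟨hq, by omega⟩; omega)
      (fun q _ _ hq => by have := m₁ q hq; omega)
      (fun q _ _ hq => hw' q (by omega) (by omega) hq)
    have A₂ := F.vertex_apex hG le_rfl le_rfl b x₂ z w (by omega) (by omega) F.ab az ax₂ aw
      (fun q _ _ hq => by have := z₂ q hq; omega)
      (fun q _ _ hq => by have := mz q ⟨hq, by omega⟩; omega)
      (fun q _ _ hq => by have := m₂ q hq; omega)
      (fun q _ _ hq => hw' q (by omega) (by omega) hq)
    omega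
  · obtain ⟨w, ⟨aw, hcw⟩, mw⟩ := Int.exists_least_of_bdd
      (P := fun r => G.Adj (p 1) (h r) ∧ c < r) ⟨c, fun z hz => hz.2.le⟩ ⟨q, hadj, hq⟩
    have hqw := mw q ⟨hadj, hq⟩
    obtain ⟨z, ⟨az, hzw⟩, mz⟩ := Int.exists_greatest_of_bdd
      (P := fun r => G.Adj a (h r) ∧ r ≤ w) ⟨w, fun z hz => hz.2⟩ ⟨c, F.ac, hcw.le⟩
    have hcz := mz c ⟨F.ac, hcw.le⟩
    have hxc : x₂ + 1 ≠ c := by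
      intro h1
      rw [h1] at ay₂
      exact hvc ay₂
    have hw' : ∀ r, z ≤ r → r ≤ w → G.Adj (p 1) (h r) → r = w := by
      intro r h1 h2 h3
      by_cases hr : r = c
      · rw [hr] at h3
        exact absurd h3 hvc
      · have := mw r ⟨h3, by omega⟩
        omega
    have A₁ := F.vertex_apex hG le_rfl le_rfl ℓ (x₁ + 1) z w (by omega) (by omega) F.al az ay₁ aw
      (fun q _ _ hq => by have := z₁ q hq; omega)
      (fun q _ _ hq => by have := mz q ⟨hq, by omega⟩; omega)
      (fun q _ _ hq => by have := m₁ q hq; omega)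
      (fun q _ _ hq => hw' q (by omega) (by omega) hq)
    have A₂ := F.vertex_apex hG le_rfl le_rfl b x₂ z w (by omega) (by omega) F.ab az ax₂ aw
      (fun q _ _ hq => by have := z₂ q hq; omega)
      (fun q _ _ hq => by have := mz q ⟨hq, by omega⟩; omega)
      (fun q _ _ hq => by have := m₂ q hq; omega)
      (fun q _ _ hq => hw' q (by omega) (by omega) hq)
    omega

theorem vertex_false_of_not_adj (F : Link G a N ℓ b c 1 h p) (hG : EvenHoleFree G)
    (hc : c = N → ¬ G.Adj (p 1) (h 0)) (hb : b = ℓ → ¬ G.Adj (p 1) (h ℓ)) : False := by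
  obtain ⟨x₁, x₂, hx₁, hx₁', hx₂, hx₂', ax₁, ay₁, ax₂, ay₂, m₁, m₂, P₁, P₂⟩ :=
    F.vertex_parities hG hc hb
  have := F.two_le
  have := F.le_b
  have := F.lt_c
  have := F.le_N
  have := F.basic hG
  have h1 : ∀ q, G.Adj (p 1) (h q) → q ≤ c ∨ N ≤ q := by
    intro q hq
    by_contra! hcon
    exact F.vertex_no_nbr_right hG hc hb hcon.1 hcon.2 hq
  have h2 : ∀ q, G.Adj (p 1) (h q) → q ≤ ℓ ∨ b ≤ q := by
    intro q hq
    by_contra! hcon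
    refine F.reflect.vertex_no_nbr_right hG (q := N + ℓ - q) ?_ ?_ (by omega) (by omega) ?_
    · intro h3
      simpa using hb (by omega)
    · intro h3
      simpa using hc (by omega)
    · rw [show ℓ - (N + ℓ - q) = q - N by ring, ← F.cyc.per, sub_add_cancel]
      exact hq
  have hyx : x₁ + 1 ≠ x₂ := by
    intro h3
    refine hb (by omega) ?_
    rwa [show x₁ + 1 = ℓ by omega] at ay₁
  have hyx' : x₂ + 1 = N → x₁ ≠ 0 := by
    rintro h3 rfl
    exact hc (by omega) ax₁
  have S₁ : (N + (x₂ + 1) + x₁) % 2 = 1 :=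
    F.vertex_arc_wrap hG le_rfl le_rfl _ _ (by omega) (by omega) (by omega) (by omega) ay₂ ax₁
      (fun q _ _ hq => by
        have := m₁ q hq
        have := m₂ q hq
        have := h1 q hq
        have := h2 q hq
        omega)
  have S₂ : (x₁ + 1 + x₂) % 2 = 1 :=
    F.vertex_arc hG le_rfl le_rfl _ _ (by omega) (by omega) ay₁ ax₂
      (fun q _ _ hq => by
        have := m₁ q hq
        have := m₂ q hq
        have := h2 q hq
        omega)
  omega

theorem vertex_false_of_adj (F : Link G a N ℓ b c 1 h p) (hG : EvenHoleFree G)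
    (hc : c = N) (h0 : G.Adj (p 1) (h 0)) : False := by
  have := F.two_le
  have := F.le_b
  have := F.lt_c
  have := F.le_N
  have := F.basic hG
  have := F.exc₁
  have := F.exc₂
  have z₁ := F.sec₁
  have z₂ := F.sec₂
  have hZ : ∀ q, G.Adj a (h q) → G.Adj (p 1) (h q) → q ≤ 1 ∨ N - 1 ≤ q := by
    intro q h1 h2
    by_contra! hcon
    exact F.common_nbrs hG le_rfl le_rfl (by omega) (by omega) F.a0 h1 h0 h2
  by_cases hu : ∃ u, ℓ < u ∧ u < b ∧ G.Adj (p 1) (h u)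
  · obtain ⟨u, hu, hu', hu''⟩ := hu
    have hau : ¬ G.Adj a (h u) := fun h1 => by
      have := hZ u h1 hu''
      omega
    obtain ⟨b', c', h3, h4, h5, h6, h7, h8, h9⟩ := exists_sector (P := fun q => G.Adj a (h q))
      hu.le hu'.le F.al F.ab hau
    have F' : Link G a N ℓ b' c' 1 h p := ⟨F.cyc, F.two_le, h3, by omega, by omega, F.a0, F.al, h7,
      h8, F.sec₁, h9, F.ah, by omega, by omega, le_rfl, F.pp, F.ap, F.ph, F.w₁, u, h4, h5, hu''⟩
    refine F'.vertex_false_of_not_adj hG (by omega) fun h1 h2 => ?_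
    have := hZ ℓ F.al h2
    omega
  · have hu' : ∀ q, G.Adj (p 1) (h q) → q ≤ ℓ ∨ b ≤ q := by
      intro q hq
      by_contra! hcon
      exact hu ⟨q, hcon.1, hcon.2, hq⟩
    obtain ⟨q₁, hq₁, hq₁', hq₁''⟩ := F.w₁
    obtain ⟨q₂, hq₂, hq₂', hq₂''⟩ := F.w₂
    obtain ⟨x₁, y₁, hx₁, hxq₁, hqy₁, hy₁, ax₁, ay₁, m₁⟩ := exists_range
      (P := fun q => G.Adj (p 1) (h q)) hq₁.le hq₁'.le hq₁''
    obtain ⟨x₂, y₂, hx₂, hxq₂, hqy₂, hy₂, ax₂, ay₂, m₂⟩ := exists_range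
      (P := fun q => G.Adj (p 1) (h q)) hq₂.le hq₂'.le hq₂''
    have S₂ : (y₁ + x₂) % 2 = 1 :=
      F.vertex_arc hG le_rfl le_rfl y₁ x₂ (by omega) (by omega) ay₁ ax₂
        (fun q _ _ hq => by
          have := m₁ q hq
          have := m₂ q hq
          have := hu' q hq
          omega)
    have R₂ : (ℓ + y₁ + b + x₂) % 2 = 1 :=
      F.vertex_apex hG le_rfl le_rfl ℓ y₁ b x₂ (by omega) (by omega) F.al F.ab ay₁ ax₂
        (fun q _ _ hq => by have := z₁ q hq; omega) (fun q _ _ hq => by have := z₂ q hq; omega)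
        (fun q _ _ hq => by have := m₁ q hq; omega) (fun q _ _ hq => by have := m₂ q hq; omega)
    omega

theorem vertex_false (F : Link G a N ℓ b c 1 h p) (hG : EvenHoleFree G) : False := by
  by_cases h1 : c = N ∧ G.Adj (p 1) (h 0)
  · exact F.vertex_false_of_adj hG h1.1 h1.2
  by_cases h2 : b = ℓ ∧ G.Adj (p 1) (h ℓ)
  · exact F.reflect.vertex_false_of_adj hG (by omega) (by simpa using h2.2)
  · exact F.vertex_false_of_not_adj hG (fun h3 h4 => h1 ⟨h3, h4⟩) fun h3 h4 => h2 ⟨h3, h4⟩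

end Link

namespace MinLink

variable {G : SimpleGraph V} {a : V} {N ℓ b c n : ℤ} {h p : ℤ → V}

theorem add_four_le (F : MinLink G a N ℓ b c n h p) (hG : EvenHoleFree G) : ℓ + 4 ≤ N := by
  have := F.le_b
  have := F.lt_c
  have := F.le_N
  have := F.basic hG
  omega

theorem two_le_n (F : MinLink G a N ℓ b c n h p) (hG : EvenHoleFree G) : 2 ≤ n := by
  by_contra hcon
  have := F.one_le
  obtain rfl : n = 1 := by omega
  exact F.vertex_false hG

theorem nbrs_close (F : MinLink G a N ℓ b c n h p) (hG : EvenHoleFree G) {k q r : ℤ}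
    (hk : 1 ≤ k) (hk' : k ≤ n) (h1 : G.Adj a (h q)) (h2 : G.Adj a (h r))
    (h3 : G.Adj (p k) (h q)) (h4 : G.Adj (p k) (h r)) : r ≤ q + 1 ∨ q + N ≤ r + 1 := by
  by_contra! hcon
  exact F.common_nbrs hG hk hk' (by omega) (by omega) h1 h2 h3 h4

theorem first_nbrs (F : MinLink G a N ℓ b c n h p) (hG : EvenHoleFree G) :
    (∃ x, 0 < x ∧ x < ℓ ∧ G.Adj (p 1) (h x) ∧ ∀ q, 0 ≤ q → q < N → G.Adj (p 1) (h q) → q = x) ∨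
    ∃ x, 0 ≤ x ∧ x < ℓ ∧ G.Adj (p 1) (h x) ∧ G.Adj (p 1) (h (x + 1)) ∧
      ((∀ q, 0 ≤ q → q < N → G.Adj (p 1) (h q) → q = x ∨ q = x + 1) ∨
        ∃ w, ℓ + 2 ≤ w ∧ w + 2 ≤ N ∧ x % 2 = 1 ∧ G.Adj a (h w) ∧ G.Adj (p 1) (h w) ∧
          ∀ q, 0 ≤ q → q < N → G.Adj (p 1) (h q) → q = x ∨ q = x + 1 ∨ q = w) := by
  obtain ⟨q₁, hq₁, hq₁', hq₁''⟩ := F.w₁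
  obtain ⟨x, y, hx, hxq, hqy, hy, ax, ay, m⟩ := exists_range
    (P := fun q => G.Adj (p 1) (h q)) hq₁.le hq₁'.le hq₁''
  have := F.two_le
  have := F.basic hG
  have := F.add_four_le hG
  have hn := F.two_le_n hG
  have z₁ := F.sec₁
  have hout : ∀ w, ℓ < w → w < N → G.Adj (p 1) (h w) → G.Adj a (h w) := by
    intro w h1 h2 h3
    rcases F.nbr hn le_rfl (by omega) (by omega) h2.le h3 with h4 | h4 | h4
    · exact h4
    · omega
    · omega
  have hout₂ : ∀ w r, ℓ < w → w < r → r < N → G.Adj (p 1) (h w) → G.Adj (p 1) (h r) → r = w + 1 := by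
    intro w r h1 h2 h3 h4 h5
    have := F.nbrs_close hG le_rfl (by omega) (hout w h1 (by omega) h4)
      (hout r (by omega) h3 h5) h4 h5
    omega
  have O₁ : ∀ w, ℓ < w → w + 2 ≤ N → G.Adj (p 1) (h w) → x % 2 = 1 := by
    intro w h1 h2 h3
    have := F.vertex_apex hG le_rfl (by omega) 0 x w w (by omega) (by omega) F.a0
      (hout w h1 (by omega) h3) ax h3 (fun q _ _ hq => by have := z₁ q hq; omega)
      (fun q _ _ hq => by omega) (fun q _ _ hq => by have := m q hq; omega)
      (fun q _ _ hq => by omega)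
    omega
  have O₂ : ∀ w, ℓ + 2 ≤ w → w < N → G.Adj (p 1) (h w) → y % 2 = 0 := by
    intro w h1 h2 h3
    have := F.vertex_apex hG le_rfl (by omega) ℓ y w w (by omega) (by omega) F.al
      (hout w (by omega) h2 h3) ay h3 (fun q _ _ hq => by have := z₁ q hq; omega)
      (fun q _ _ hq => by omega) (fun q _ _ hq => by have := m q hq; omega)
      (fun q _ _ hq => by omega)
    omega
  have T : (x + y) % 2 = 0 ∨ y = x + 1 := by
    by_contra! hcon
    have := F.vertex_apex hG le_rfl (by omega) 0 x ℓ y (by omega) (by omega) F.a0 F.al ax ay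
      (fun q _ _ hq => by have := z₁ q hq; omega) (fun q _ _ hq => by have := z₁ q hq; omega)
      (fun q _ _ hq => by have := m q hq; omega) (fun q _ _ hq => by have := m q hq; omega)
    omega
  by_cases hw : ∃ w, ℓ < w ∧ w < N ∧ G.Adj (p 1) (h w)
  · obtain ⟨w, hw, hw', hw''⟩ := hw
    by_cases hw₂ : ∃ r, ℓ < r ∧ r < N ∧ G.Adj (p 1) (h r) ∧ r ≠ w
    · exfalso
      obtain ⟨u, hu, hu', au, av⟩ : ∃ u, ℓ < u ∧ u + 1 < N ∧ G.Adj (p 1) (h u) ∧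
          G.Adj (p 1) (h (u + 1)) := by
        obtain ⟨r, hr, hr', hr'', hrw⟩ := hw₂
        rcases lt_or_gt_of_ne hrw with h1 | h1
        · have := hout₂ r w hr h1 hw' hr'' hw''
          exact ⟨r, hr, by omega, hr'', this ▸ hw''⟩
        · have := hout₂ w r hw h1 hr' hw'' hr''
          exact ⟨w, hw, by omega, hw'', this ▸ hr''⟩
      have m' : ∀ q, G.Adj (p 1) (h q) → q ≤ ℓ ∨ N ≤ q ∨ q = u ∨ q = u + 1 := by
        intro q hq
        by_contra! hcon
        rcases lt_or_gt_of_ne hcon.2.2.1 with h1 | h1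
        · have := hout₂ q (u + 1) hcon.1 (by omega) (by omega) hq av
          omega
        · have := hout₂ u q (by omega) (by omega) hcon.2.1 au hq
          omega
      have h1 := O₁ u hu (by omega) au
      have h2 := O₂ (u + 1) (by omega) (by omega) av
      have h3 := F.vertex_arc hG le_rfl (by omega) y u (by omega) (by omega) ay au
        (fun q _ _ hq => by have := m q hq; have := m' q hq; omega)
      have h4 := F.vertex_arc_wrap hG le_rfl (by omega) (u + 1) x (by omega) (by omega) (by omega)
        (by omega) av ax (fun q _ _ hq => by have := m q hq; have := m' q hq; omega)
      omega
    · have m' : ∀ q, G.Adj (p 1) (h q) → q ≤ ℓ ∨ N ≤ q ∨ q = w := by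
        intro q hq
        by_contra! hcon
        exact hw₂ ⟨q, hcon.1, hcon.2.1, hq, hcon.2.2⟩
      have h1 := O₁ w hw
      have h2 := O₂ w
      have h3 : w + 1 = N → (y + w) % 2 = 1 := fun _ =>
        F.vertex_arc hG le_rfl (by omega) y w (by omega) (by omega) ay hw''
          (fun q _ _ hq => by have := m q hq; have := m' q hq; omega)
      have h3' : w = ℓ + 1 → (y + w) % 2 = 1 := fun _ =>
        F.vertex_arc hG le_rfl (by omega) y w (by omega) (by omega) ay hw''
          (fun q _ _ hq => by have := m q hq; have := m' q hq; omega)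
      have h4 := F.vertex_arc_wrap hG le_rfl (by omega) w x (by omega) (by omega) (by omega)
        (by omega) hw'' ax (fun q _ _ hq => by have := m q hq; have := m' q hq; omega)
      have h5 : w ≠ N - 1 := by
        intro h5
        have := h2 (by omega) hw' hw''
        have := h3 (by omega)
        omega
      have h6 : w ≠ ℓ + 1 := by
        intro h6
        have := h1 (by omega) hw''
        have := h3' (by omega)
        omega
      have h7 := h1 (by omega) hw''
      have h8 := h2 (by omega) hw' hw''
      obtain rfl : y = x + 1 := by omega
      refine .inr ⟨x, hx, by omega, ax, ay, .inr ⟨w, by omega, by omega, h7, hout w hw hw' hw'', hw'',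
        fun q _ _ hq => ?_⟩⟩
      have := m q hq
      have := m' q hq
      omega
  · have m' : ∀ q, G.Adj (p 1) (h q) → q ≤ ℓ ∨ N ≤ q := by
      intro q hq
      by_contra! hcon
      exact hw ⟨q, hcon.1, hcon.2, hq⟩
    rcases lt_trichotomy y (x + 1) with h1 | rfl | h1
    · refine .inl ⟨x, by omega, by omega, ax, fun q _ _ hq => ?_⟩
      have := m q hq
      have := m' q hq
      omega
    · refine .inr ⟨x, hx, by omega, ax, ay, .inl fun q _ _ hq => ?_⟩
      have := m q hq
      have := m' q hq
      omega
    · refine absurd ?_ id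
      refine F.reroute (j := 1) (u := x) (v := y) le_rfl (by omega) hx (by omega) hy ay ax ?_
      intro k q hk hk' hq hq' hq'' hadj
      obtain rfl : k = 1 := by omega
      have := m q hadj
      have := m' q hadj
      omega

theorem mid_nbrs (F : MinLink G a N ℓ b c n h p) (hG : EvenHoleFree G) {k r : ℤ} (hk : 2 ≤ k)
    (hk' : k < n) (hr : 0 ≤ r) (hr' : r ≤ N) (hadj : G.Adj (p k) (h r)) :
    ∃ w w', ℓ ≤ w ∧ (w' = w ∨ w' = w + 1) ∧ w' ≤ N ∧ G.Adj (p k) (h w) ∧ G.Adj (p k) (h w') ∧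
      G.Adj a (h w) ∧ G.Adj a (h w') ∧ ∀ q, 0 ≤ q → q ≤ N → G.Adj (p k) (h q) →
        q = w ∨ q = w' ∨ (w' = N ∧ q = 0) := by
  have hn := F.two_le_n hG
  have hN := F.hN
  have hl := F.two_le
  have hl' := F.add_four_le hG
  have hodd := F.basic hG
  have hZ : ∀ q, 0 ≤ q → q ≤ N → G.Adj (p k) (h q) → G.Adj a (h q) ∧ (q = 0 ∨ ℓ ≤ q) := by
    intro q h1 h2 h3
    rcases F.nbr hn (by omega) (by omega) h1 h2 h3 with h4 | h4 | h4
    · have := F.sec₁ q h4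
      exact ⟨h4, by omega⟩
    · omega
    · omega
  obtain ⟨r', hr₁, hr₂, hr₃⟩ : ∃ r', ℓ ≤ r' ∧ r' ≤ N ∧ G.Adj (p k) (h r') := by
    rcases (hZ r hr hr' hadj).2 with rfl | h1
    · exact ⟨N, by omega, le_rfl, hN ▸ hadj⟩
    · exact ⟨r, h1, hr', hadj⟩
  obtain ⟨w, w', h1, h2, h3, h4, h5, h6, h7⟩ := exists_range
    (P := fun q => G.Adj (p k) (h q)) hr₁ hr₂ hr₃
  have aw := (hZ w (by omega) (by omega) h5).1
  have aw' := (hZ w' (by omega) (by omega) h6).1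
  have hww : w' = w ∨ w' = w + 1 := by
    have := F.nbrs_close hG (by omega) (by omega) aw aw' h5 h6
    omega
  refine ⟨w, w', h1, hww, h4, h5, h6, aw, aw', fun q hq hq' hq'' => ?_⟩
  rcases (hZ q hq hq' hq'').2 with h8 | h8
  · subst h8
    have := h7 N (hN ▸ hq'') (by omega) le_rfl
    omega
  · have := h7 q hq'' h8 hq'
    omega

/-- The first vertex after `p 1` having a neighbour on the hole. -/
theorem first_attach (F : MinLink G a N ℓ b c n h p) (hG : EvenHoleFree G) {x y i w w' : ℤ}
    (hx : 0 ≤ x) (hxl : x < ℓ) (hy : 0 < y) (hyl : y ≤ ℓ) (hxy : y = x ∨ y = x + 1)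
    (ax : G.Adj (p 1) (h x)) (ay : G.Adj (p 1) (h y))
    (hi : 2 ≤ i) (hin : i < n) (hw : ℓ ≤ w) (hww : w' = w ∨ w' = w + 1) (hw' : w' ≤ N)
    (aw : G.Adj (p i) (h w)) (aw' : G.Adj (p i) (h w')) (zw : G.Adj a (h w))
    (zw' : G.Adj a (h w'))
    (hall : ∀ k q, 1 ≤ k → k ≤ i → 0 ≤ q → q ≤ N → G.Adj (p k) (h q) →
      (k = 1 ∧ (q = x ∨ q = y ∨ (x = 0 ∧ q = N))) ∨ (k = i ∧ (q = w ∨ q = w' ∨ (w' = N ∧ q = 0)))) :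
    (w = N ∧ y = 1) ∨ (w' = ℓ ∧ x = ℓ - 1) ∨
      (y = x + 1 ∧ w' = w ∧ ℓ + 2 ≤ w ∧ w + 2 ≤ N ∧ (x + i) % 2 = 0) := by
  have hN := F.hN
  have hl := F.two_le
  have hl' := F.add_four_le hG
  have hodd := F.basic hG
  have z₁ := F.sec₁
  have R₀ : ∀ r, (r = w ∨ r = w') → ℓ + 1 ≤ r → r + 2 ≤ N → w' < N → x + 2 ≤ r →
      (x + i) % 2 = 0 := by
    intro r hr h1 h2 h3 _
    have := F.apex hG 1 i 0 x r r le_rfl (by omega) (by omega) (by omega) (by omega) F.a0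
      (by rcases hr with rfl | rfl <;> assumption) ax (by rcases hr with rfl | rfl <;> assumption)
      (fun q _ _ hq => by have := z₁ q hq; omega) (fun q _ _ hq => by omega)
      (fun k q _ _ _ _ hq => by have := hall k q (by omega) (by omega) (by omega) (by omega) hq; omega)
      (fun k q _ _ _ _ hq => by have := hall k q (by omega) (by omega) (by omega) (by omega) hq; omega)
    omega
  have R₁ : ∀ r, (r = w ∨ r = w') → ℓ + 2 ≤ r → r + 2 ≤ y + N → r < N → ℓ < w →
      (ℓ + y + i) % 2 = 0 := by
    intro r hr h1 h2 h3 _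
    have := F.apex hG 1 i ℓ y r r le_rfl (by omega) (by omega) (by omega) (by omega) F.al
      (by rcases hr with rfl | rfl <;> assumption) ay (by rcases hr with rfl | rfl <;> assumption)
      (fun q _ _ hq => by have := z₁ q hq; omega) (fun q _ _ hq => by omega)
      (fun k q _ _ _ _ hq => by have := hall k q (by omega) (by omega) (by omega) (by omega) hq; omega)
      (fun k q _ _ _ _ hq => by have := hall k q (by omega) (by omega) (by omega) (by omega) hq; omega)
    omega
  have A₁ : w ≤ N - 2 + y → w ≤ N → (y + w + 1 + i) % 2 = 1 ∨ (w = N ∧ x = 0) := by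
    intro h1 h2
    by_contra! hcon
    refine hcon.1 (F.arc hG 1 i y w le_rfl (by omega) (by omega) (by omega) (by omega) ay aw
      (fun k q _ _ _ _ hq => ?_))
    have := hall k q (by omega) (by omega) (by omega) (by omega) hq
    omega
  have A₂ : x + 2 ≤ w' → (N + w' + x + 1 + i) % 2 = 1 ∨ (w' = ℓ ∧ y = ℓ) := by
    intro h1
    by_contra! hcon
    refine hcon.1 (F.arc_wrap hG 1 i w' x le_rfl (by omega) (by omega) (by omega) (by omega)
      (by omega) (by omega) ax aw' (fun k q _ _ _ _ _ hq => ?_))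
    have := hall k q (by omega) (by omega) (by omega) (by omega) hq
    omega
  rcases hxy with hxy | hxy <;> rcases hww with hww | hww
  · by_cases h1 : w = N ∧ y = 1
    · exact .inl h1
    by_cases h2 : w' = ℓ ∧ x = ℓ - 1
    · exact .inr (.inl h2)
    exfalso
    have := A₁ (by omega) (by omega)
    have := A₂ (by omega)
    omega
  · exfalso
    have e₀ : (x + i) % 2 = 0 := by
      by_cases h1 : w' + 2 ≤ N
      · exact R₀ w' (.inr rfl) (by omega) h1 (by omega) (by omega)
      by_cases h2 : w' + 1 = N
      · exact R₀ w (.inl rfl) (by omega) (by omega) (by omega) (by omega)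
      have := F.arc hG 1 i x 0 le_rfl (by omega) (by omega) (by omega) (by omega) ax
        (by have : w' = N := by omega
            rw [← hN, ← this]; exact aw')
        (fun k q _ _ _ _ hq => by
          have := hall k q (by omega) (by omega) (by omega) (by omega) hq; omega)
      omega
    have e₁ : (ℓ + y + i) % 2 = 0 := by
      by_cases h1 : w = ℓ
      · have := A₁ (by omega) (by omega)
        omega
      by_cases h2 : w' < N
      · exact R₁ w' (.inr rfl) (by omega) (by omega) h2 (by omega)
      · exact R₁ w (.inl rfl) (by omega) (by omega) (by omega) (by omega)
    omega
  · by_cases h1 : w = N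
    · by_cases h2 : x = 0
      · exact .inl ⟨h1, by omega⟩
      exfalso
      refine F.reroute (j := i) (u := 0) (v := y) (by omega) hin le_rfl (by omega) hyl ay
        (by rw [← hN, ← h1]; exact aw) (fun k q _ _ _ _ _ hq => ?_)
      have := hall k q (by omega) (by omega) (by omega) (by omega) hq
      omega
    by_cases h2 : w' = ℓ
    · by_cases h3 : x = ℓ - 1
      · exact .inr (.inl ⟨h2, h3⟩)
      exfalso
      refine F.reflect.reroute (j := i) (u := 0) (v := ℓ - x) (by omega) hin le_rfl (by omega)
        (by omega) (by simpa using ax) (by simpa [← h2] using aw') (fun k q _ _ _ _ h7 hq => ?_)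
      rcases le_or_gt 0 (ℓ - q) with h8 | h8
      · have := hall k (ℓ - q) (by omega) (by omega) (by omega) (by omega) hq
        omega
      · rw [← F.cyc.per] at hq
        have := hall k (ℓ - q + N) (by omega) (by omega) (by omega) (by omega) hq
        omega
    refine .inr (.inr ⟨hxy, hww, ?_⟩)
    by_cases h3 : w + 1 = N
    · have := A₂ (by omega)
      have := R₁ w (.inl rfl) (by omega) (by omega) (by omega) (by omega)
      omega
    by_cases h4 : w = ℓ + 1
    · have := A₁ (by omega) (by omega)
      have := R₀ w (.inl rfl) (by omega) (by omega) (by omega) (by omega)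
      omega
    exact ⟨by omega, by omega, R₀ w (.inl rfl) (by omega) (by omega) (by omega) (by omega)⟩
  · by_cases h1 : w = N ∧ y = 1
    · omega
    by_cases h2 : w' = ℓ ∧ x = ℓ - 1
    · omega
    exfalso
    have := A₁ (by omega) (by omega)
    have := A₂ (by omega)
    omega

end MinLink

theorem exists_first {P : ℤ → Prop} {lo hi : ℤ} (h1 : lo ≤ hi) (h2 : P hi) :
    ∃ m, lo ≤ m ∧ m ≤ hi ∧ P m ∧ ∀ k, lo ≤ k → k < m → ¬ P k := by
  obtain ⟨m, _, hm, hm', _, _, hP, _, hall⟩ := exists_range h1 le_rfl h2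
  exact ⟨m, hm, hm', hP, fun k hk hk' hPk => by have := hall k hPk hk (by omega); omega⟩

theorem exists_last {P : ℤ → Prop} {lo hi : ℤ} (h1 : lo ≤ hi) (h2 : P lo) :
    ∃ j, lo ≤ j ∧ j ≤ hi ∧ P j ∧ ∀ k, j < k → k ≤ hi → ¬ P k := by
  obtain ⟨_, j, _, hj, hj', hj'', _, hP, hall⟩ := exists_range le_rfl h1 h2
  exact ⟨j, by omega, hj'', hP, fun k hk hk' hPk => by have := hall k hPk (by omega) hk'; omega⟩

namespace MinLink

variable {G : SimpleGraph V} {a : V} {N ℓ b c n : ℤ} {h p : ℤ → V}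

theorem last_nbrs (F : MinLink G a N ℓ b c n h p) (hG : EvenHoleFree G) :
    ∃ x y, b ≤ x ∧ x < c ∧ b < y ∧ y ≤ c ∧ (y = x ∨ y = x + 1) ∧ G.Adj (p n) (h x) ∧
      G.Adj (p n) (h y) ∧
      ((∀ q, 0 ≤ q → q ≤ N → G.Adj (p n) (h q) → q = x ∨ q = y ∨ (y = N ∧ q = 0)) ∨
        (y = x + 1 ∧ (x + b) % 2 = 1 ∧ (y + c) % 2 = 1 ∧ ∃ w, ℓ ≤ w ∧ w ≤ N ∧
          (w + 2 ≤ b ∨ c + 2 ≤ w) ∧ G.Adj a (h w) ∧ G.Adj (p n) (h w) ∧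
          ∀ q, 0 ≤ q → q ≤ N → G.Adj (p n) (h q) →
            q = x ∨ q = y ∨ q = w ∨ (w = N ∧ q = 0))) := by
  have hl := F.two_le
  have hb := F.le_b
  have hc := F.le_N
  have hodd := F.basic hG
  have hper := F.cyc.per
  have e1 : n + 1 - 1 = n := by omega
  rcases F.swap.first_nbrs hG with ⟨x, h1, h2, h3, h4⟩ | ⟨x, h1, h2, h3, h3', h4⟩
  · simp only [e1] at h3 h4
    refine ⟨x + b, x + b, by omega, by omega, by omega, by omega, .inl rfl, h3, h3,
      .inl fun q hq hq' hq'' => ?_⟩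
    rcases le_or_gt b q with h5 | h5
    · have := h4 (q - b) (by omega) (by omega) (by simpa using hq'')
      omega
    · have := h4 (q - b + N) (by omega) (by omega) (by
        rw [show q - b + N + b = q + N by omega, hper]; exact hq'')
      omega
  · simp only [e1] at h3 h3' h4
    refine ⟨x + b, x + b + 1, by omega, by omega, by omega, by omega, .inr rfl, h3,
      by rw [show x + b + 1 = x + 1 + b by omega]; exact h3', ?_⟩
    rcases h4 with h4 | ⟨w, hw, hw', hx, aw, pw, h4⟩
    · refine .inl fun q hq hq' hq'' => ?_
      rcases le_or_gt b q with h5 | h5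
      · have := h4 (q - b) (by omega) (by omega) (by simpa using hq'')
        omega
      · have := h4 (q - b + N) (by omega) (by omega) (by
          rw [show q - b + N + b = q + N by omega, hper]; exact hq'')
        omega
    · refine .inr ⟨rfl, by omega, by omega, ?_⟩
      rcases le_or_gt (w + b) N with h6 | h6
      · refine ⟨w + b, by omega, by omega, by omega, aw, pw, fun q hq hq' hq'' => ?_⟩
        rcases le_or_gt b q with h5 | h5
        · have := h4 (q - b) (by omega) (by omega) (by simpa using hq'')
          omega
        · have := h4 (q - b + N) (by omega) (by omega) (by
            rw [show q - b + N + b = q + N by omega, hper]; exact hq'')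
          omega
      · have aw' : G.Adj a (h (w + b - N)) := by
          rw [← hper, show w + b - N + N = w + b by omega]; exact aw
        have pw' : G.Adj (p n) (h (w + b - N)) := by
          rw [← hper, show w + b - N + N = w + b by omega]; exact pw
        have := F.sec₁ _ aw'
        refine ⟨w + b - N, by omega, by omega, by omega, aw', pw', fun q hq hq' hq'' => ?_⟩
        rcases le_or_gt b q with h5 | h5
        · have := h4 (q - b) (by omega) (by omega) (by simpa using hq'')
          omega
        · have := h4 (q - b + N) (by omega) (by omega) (by
            rw [show q - b + N + b = q + N by omega, hper]; exact hq'')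
          omega

set_option maxHeartbeats 2000000 in
/-- The case where the first attachment of the path lies next to the neighbours of `p 1`. -/
theorem false_of_attach_end (F : MinLink G a N ℓ b c n h p) (hG : EvenHoleFree G) {i : ℤ}
    (a1 : G.Adj (p 1) (h 1)) (hi : 2 ≤ i) (hin : i < n) (ai : G.Adj (p i) (h N))
    (hall : ∀ k q, 1 ≤ k → k ≤ i → 0 ≤ q → q ≤ N → G.Adj (p k) (h q) →
      q = 0 ∨ q = N ∨ (k = 1 ∧ q = 1)) : False := by
  have hN := F.hN
  have hl := F.two_le
  have hl' := F.add_four_le hG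
  have hb := F.le_b
  have hbc := F.lt_c
  have hc := F.le_N
  have hodd := F.basic hG
  have z₁ := F.sec₁
  have z₂ := F.sec₂
  obtain ⟨m, him, hmn, ⟨r, hr, hr', hr''⟩, hfirst⟩ := exists_first
    (P := fun k => ∃ q, 0 < q ∧ q < N ∧ G.Adj (p k) (h q)) (show i + 1 ≤ n by omega)
    (by obtain ⟨q, h1, h2, h3⟩ := F.w₂; exact ⟨q, by omega, by omega, h3⟩)
  obtain ⟨j, hij, hjm, aj, hlast⟩ := exists_last
    (P := fun k => G.Adj (p k) (h N)) (show i ≤ m - 1 by omega) ai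
  have aj₀ : G.Adj (p j) (h 0) := hN ▸ aj
  have H₁ : ∀ k q, 1 ≤ k → k < m → 0 ≤ q → q ≤ N → G.Adj (p k) (h q) →
      q = 0 ∨ q = N ∨ (k = 1 ∧ q = 1) := by
    intro k q h1 h2 h3 h4 h5
    rcases le_or_gt k i with h6 | h6
    · exact hall k q h1 h6 h3 h4 h5
    · by_contra! hcon
      exact hfirst k (by omega) h2 ⟨q, by omega, by omega, h5⟩
  have H₂ : ∀ k q, j ≤ k → k < m → 0 ≤ q → q ≤ N → G.Adj (p k) (h q) →
      k = j ∧ (q = 0 ∨ q = N) := by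
    intro k q h1 h2 h3 h4 h5
    have h6 := H₁ k q (by omega) h2 h3 h4 h5
    refine ⟨?_, by omega⟩
    by_contra hne
    refine hlast k (by omega) (by omega) ?_
    rcases h6 with rfl | rfl | h6
    · exact hN ▸ h5
    · exact h5
    · omega
  clear hall hfirst hlast
  rcases hmn.lt_or_eq with hmn | rfl
  · obtain ⟨v, v', hv, hvv, hv', av, av', zv, zv', hm⟩ := F.mid_nbrs hG (by omega) hmn hr.le hr'.le hr''
    have hvN : v < N := by have := hm r hr.le hr'.le hr''; omega
    have E₁ := F.arc hG 1 m 1 v le_rfl (by omega) (by omega) (by omega) (by omega) a1 av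
      (fun k q _ _ _ _ hq => by
        rcases eq_or_ne k m with rfl | hk
        · have := hm q (by omega) (by omega) hq; omega
        · have := H₁ k q (by omega) (by omega) (by omega) (by omega) hq; omega)
    have E₂ : ∀ t, (t = v ∨ t = v') → ℓ + 2 ≤ t → t < N → (ℓ + 1 + t + t + 1 + m) % 2 = 1 := by
      intro t ht h1 h2
      exact F.apex hG 1 m ℓ 1 t t le_rfl (by omega) (by omega) (by omega) (by omega) F.al
        (by rcases ht with rfl | rfl <;> assumption) a1
        (by rcases ht with rfl | rfl <;> assumption)
        (fun q _ _ hq => by have := z₁ q hq; omega) (fun q _ _ hq => by omega)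
        (fun k q _ _ _ _ hq => by
          rcases eq_or_ne k m with rfl | hk
          · have := hm q (by omega) (by omega) hq; omega
          · have := H₁ k q (by omega) (by omega) (by omega) (by omega) hq; omega)
        (fun k q _ _ _ _ hq => by
          rcases eq_or_ne k m with rfl | hk
          · omega
          · have := H₁ k q (by omega) (by omega) (by omega) (by omega) hq; omega)
    have E₂' : ℓ + 1 ≤ v → v' ≠ ℓ + 1 → m % 2 = 0 := by
      intro h1 h2
      by_cases h3 : v = ℓ + 1
      · have := E₂ v' (.inr rfl) (by omega) (by omega); omega
      · have := E₂ v (.inl rfl) (by omega) (by omega); omega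
    by_cases h1 : v = N - 1
    · have := E₂' (by omega) (by omega)
      omega
    have E₃ := F.arc hG j m N v' (by omega) (by omega) (by omega) (by omega) (by omega) aj av'
      (fun k q _ _ _ _ hq => by
        rcases eq_or_ne k m with rfl | hk
        · have := hm q (by omega) (by omega) hq; omega
        · have := H₂ k q (by omega) (by omega) (by omega) (by omega) hq; omega)
    rcases hvv with rfl | rfl
    · have := F.arc hG j m 0 v' (by omega) (by omega) (by omega) (by omega) (by omega) aj₀ av'
        (fun k q _ _ _ _ hq => by
          rcases eq_or_ne k m with rfl | hk
          · have := hm q (by omega) (by omega) hq; omega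
          · have := H₂ k q (by omega) (by omega) (by omega) (by omega) hq; omega)
      omega
    · have := F.apex hG j m 0 0 v v (by omega) (by omega) (by omega) (by omega) (by omega) F.a0
        zv aj₀ av (fun q _ _ hq => by omega) (fun q _ _ hq => by omega)
        (fun k q _ _ _ _ hq => by
          rcases eq_or_ne k m with rfl | hk
          · have := hm q (by omega) (by omega) hq; omega
          · have := H₂ k q (by omega) (by omega) (by omega) (by omega) hq; omega)
        (fun k q _ _ _ _ hq => by
          rcases eq_or_ne k m with rfl | hk
          · omega
          · have := H₂ k q (by omega) (by omega) (by omega) (by omega) hq; omega)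
      omega
  · have hexc := F.exc₂
    obtain ⟨x, y, hx, hxc, hy, hyc, hxy, ax, ay, hm⟩ := F.last_nbrs hG
    rcases hm with hm | ⟨hxy', hx2, hy2, w, hw, hwN, hwbc, zw, aw, hm⟩
    · have E₁ := F.arc hG 1 m 1 x le_rfl (by omega) (by omega) (by omega) (by omega) a1 ax
        (fun k q _ _ _ _ hq => by
          rcases eq_or_ne k m with rfl | hk
          · have := hm q (by omega) (by omega) hq; omega
          · have := H₁ k q (by omega) (by omega) (by omega) (by omega) hq; omega)
      by_cases hcN : c = N
      · have := F.apex hG 1 m ℓ 1 b x le_rfl (by omega) (by omega) (by omega) (by omega) F.al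
          F.ab a1 ax
          (fun q _ _ hq => by have := z₁ q hq; omega) (fun q _ _ hq => by have := z₂ q hq; omega)
          (fun k q _ _ _ _ hq => by
            rcases eq_or_ne k m with rfl | hk
            · have := hm q (by omega) (by omega) hq; omega
            · have := H₁ k q (by omega) (by omega) (by omega) (by omega) hq; omega)
          (fun k q _ _ _ _ hq => by
            rcases eq_or_ne k m with rfl | hk
            · have := hm q (by omega) (by omega) hq; omega
            · have := H₁ k q (by omega) (by omega) (by omega) (by omega) hq; omega)
        omega
      have E₃ := F.arc hG j m N y (by omega) (by omega) (by omega) (by omega) (by omega) aj ay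
        (fun k q _ _ _ _ hq => by
          rcases eq_or_ne k m with rfl | hk
          · have := hm q (by omega) (by omega) hq; omega
          · have := H₂ k q (by omega) (by omega) (by omega) (by omega) hq; omega)
      rcases hxy with rfl | rfl
      · have := F.arc hG j m 0 y (by omega) (by omega) (by omega) (by omega) (by omega) aj₀ ay
          (fun k q _ _ _ _ hq => by
            rcases eq_or_ne k m with rfl | hk
            · have := hm q (by omega) (by omega) hq; omega
            · have := H₂ k q (by omega) (by omega) (by omega) (by omega) hq; omega)
        omega
      · have E₄ := F.apex hG j m 0 0 b x (by omega) (by omega) (by omega) (by omega) (by omega) F.a0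
          F.ab aj₀ ax (fun q _ _ hq => by omega) (fun q _ _ hq => by have := z₂ q hq; omega)
          (fun k q _ _ _ _ hq => by
            rcases eq_or_ne k m with rfl | hk
            · have := hm q (by omega) (by omega) hq; omega
            · have := H₂ k q (by omega) (by omega) (by omega) (by omega) hq; omega)
          (fun k q _ _ _ _ hq => by
            rcases eq_or_ne k m with rfl | hk
            · have := hm q (by omega) (by omega) hq; omega
            · have := H₂ k q (by omega) (by omega) (by omega) (by omega) hq; omega)
        by_cases h1 : x = ℓ
        · omega
        have := F.apex hG 1 m ℓ 1 c (x + 1) le_rfl (by omega) (by omega) (by omega) (by omega) F.al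
          F.ac a1 ay
          (fun q _ _ hq => by have := z₁ q hq; omega) (fun q _ _ hq => by have := z₂ q hq; omega)
          (fun k q _ _ _ _ hq => by
            rcases eq_or_ne k m with rfl | hk
            · have := hm q (by omega) (by omega) hq; omega
            · have := H₁ k q (by omega) (by omega) (by omega) (by omega) hq; omega)
          (fun k q _ _ _ _ hq => by
            rcases eq_or_ne k m with rfl | hk
            · have := hm q (by omega) (by omega) hq; omega
            · have := H₁ k q (by omega) (by omega) (by omega) (by omega) hq; omega)
        omega
    · have E₀ : w ≠ ℓ → c < N → (ℓ + 1 + c + y + 1 + m) % 2 = 1 := fun _ _ =>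
        F.apex hG 1 m ℓ 1 c y le_rfl (by omega) (by omega) (by omega) (by omega) F.al
          F.ac a1 ay
          (fun q _ _ hq => by have := z₁ q hq; omega) (fun q _ _ hq => by have := z₂ q hq; omega)
          (fun k q _ _ _ _ hq => by
            rcases eq_or_ne k m with rfl | hk
            · have := hm q (by omega) (by omega) hq; omega
            · have := H₁ k q (by omega) (by omega) (by omega) (by omega) hq; omega)
          (fun k q _ _ _ _ hq => by
            rcases eq_or_ne k m with rfl | hk
            · have := hm q (by omega) (by omega) hq; omega
            · have := H₁ k q (by omega) (by omega) (by omega) (by omega) hq; omega)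
      by_cases h1 : w = N
      · have E₁ := F.arc hG 1 m 1 x le_rfl (by omega) (by omega) (by omega) (by omega) a1 ax
          (fun k q _ _ _ _ hq => by
            rcases eq_or_ne k m with rfl | hk
            · have := hm q (by omega) (by omega) hq; omega
            · have := H₁ k q (by omega) (by omega) (by omega) (by omega) hq; omega)
        have E₂ := F.arc hG m m y N (by omega) (by omega) (by omega) (by omega) (by omega) ay
          (h1 ▸ aw) (fun k q _ _ _ _ hq => by
            obtain rfl : k = m := by omega
            have := hm q (by omega) (by omega) hq; omega)
        have := E₀ (by omega) (by omega)
        omega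
      · have E₂ := F.apex hG j m 0 0 b x (by omega) (by omega) (by omega) (by omega) (by omega) F.a0
          F.ab aj₀ ax (fun q _ _ hq => by omega) (fun q _ _ hq => by have := z₂ q hq; omega)
          (fun k q _ _ _ _ hq => by
            rcases eq_or_ne k m with rfl | hk
            · have := hm q (by omega) (by omega) hq; omega
            · have := H₂ k q (by omega) (by omega) (by omega) (by omega) hq; omega)
          (fun k q _ _ _ _ hq => by
            rcases eq_or_ne k m with rfl | hk
            · have := hm q (by omega) (by omega) hq; omega
            · have := H₂ k q (by omega) (by omega) (by omega) (by omega) hq; omega)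
        by_cases h2 : w + 2 ≤ N
        · have E₃ := F.apex hG j m 0 0 w w (by omega) (by omega) (by omega) (by omega) (by omega)
            F.a0 zw aj₀ aw (fun q _ _ hq => by omega) (fun q _ _ hq => by omega)
            (fun k q _ _ _ _ hq => by
              rcases eq_or_ne k m with rfl | hk
              · have := hm q (by omega) (by omega) hq; omega
              · have := H₂ k q (by omega) (by omega) (by omega) (by omega) hq; omega)
            (fun k q _ _ _ _ hq => by
              rcases eq_or_ne k m with rfl | hk
              · omega
              · have := H₂ k q (by omega) (by omega) (by omega) (by omega) hq; omega)
          omega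
        · have E₃ := F.apex hG 1 m ℓ 1 w w le_rfl (by omega) (by omega) (by omega) (by omega)
            F.al zw a1 aw (fun q _ _ hq => by have := z₁ q hq; omega) (fun q _ _ hq => by omega)
            (fun k q _ _ _ _ hq => by
              rcases eq_or_ne k m with rfl | hk
              · have := hm q (by omega) (by omega) hq; omega
              · have := H₁ k q (by omega) (by omega) (by omega) (by omega) hq; omega)
            (fun k q _ _ _ _ hq => by
              rcases eq_or_ne k m with rfl | hk
              · omega
              · have := H₁ k q (by omega) (by omega) (by omega) (by omega) hq; omega)
          have := E₀ (by omega) (by omega)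
          omega

set_option maxHeartbeats 2000000 in
theorem false_of_attach_far_aux (F : MinLink G a N ℓ b c n h p) (hG : EvenHoleFree G)
    {x i w m : ℤ} (hx : 0 ≤ x) (hxl : x < ℓ) (ax : G.Adj (p 1) (h x))
    (ay : G.Adj (p 1) (h (x + 1))) (hi : 1 ≤ i) (him : i < m) (hmn : m ≤ n) (hw : ℓ + 2 ≤ w)
    (hwN : w + 2 ≤ N) (aw : G.Adj (p i) (h w)) (zw : G.Adj a (h w)) (hxi : (x + i) % 2 = 0)
    (H : ∀ k q, 1 ≤ k → k < m → 0 ≤ q → q ≤ N → G.Adj (p k) (h q) →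
      (k = 1 ∧ (q = x ∨ q = x + 1 ∨ (x = 0 ∧ q = N))) ∨ (i ≤ k ∧ q = w))
    (hlt : m < n → ∃ q, w < q ∧ q ≤ N ∧ G.Adj (p m) (h q)) (heq : m = n → w ≤ b) : False := by
  have hN := F.hN
  have hper := F.cyc.per
  have hl := F.two_le
  have hl' := F.add_four_le hG
  have hb := F.le_b
  have hbc := F.lt_c
  have hc := F.le_N
  have hodd := F.basic hG
  have z₁ := F.sec₁
  have z₂ := F.sec₂
  obtain ⟨j, hij, hjm, aj, hlast⟩ := exists_last
    (P := fun k => G.Adj (p k) (h w)) (show i ≤ m - 1 by omega) aw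
  have wodd : w % 2 = 1 := by
    have := F.arc_wrap hG 1 i w x le_rfl (by omega) (by omega) (by omega) (by omega) (by omega)
      (by omega) ax aw (fun k q _ _ _ _ _ hq => by
        have := H k q (by omega) (by omega) (by omega) (by omega) hq; omega)
    omega
  have H₂ : ∀ k q, j ≤ k → k < m → 0 ≤ q → q ≤ N → G.Adj (p k) (h q) →
      (k = j ∧ q = w) ∨ (k = j ∧ j = 1 ∧ (q = x ∨ q = x + 1 ∨ (x = 0 ∧ q = N))) := by
    intro k q h1 h2 h3 h4 h5
    have h6 := H k q (by omega) h2 h3 h4 h5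
    rcases h6 with h6 | ⟨h6, rfl⟩
    · omega
    · have : ¬ j < k := fun h7 => hlast k h7 (by omega) h5
      omega
  clear hlast
  rcases hmn.lt_or_eq with hmn | rfl
  · obtain ⟨r, hr, hr', hr''⟩ := hlt hmn
    obtain ⟨v, v', hv, hvv, hv', av, av', zv, zv', hm⟩ := F.mid_nbrs hG (by omega) hmn (by omega) hr' hr''
    have hwv : w < v' := by have := hm r (by omega) hr' hr''; omega
    clear hr hr' hr'' hlt heq
    have E₁ : (x + m) % 2 = 0 := by
      by_cases h1 : v' = N
      · have := F.arc hG 1 m x 0 le_rfl (by omega) (by omega) (by omega) (by omega) ax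
          (by rw [← hN, ← h1]; exact av') (fun k q _ _ _ _ hq => by
            rcases eq_or_ne k m with rfl | hk
            · have := hm q (by omega) (by omega) hq; omega
            · have := H k q (by omega) (by omega) (by omega) (by omega) hq; omega)
        omega
      · have := F.apex hG 1 m ℓ (x + 1) v' v' le_rfl (by omega) (by omega) (by omega) (by omega)
          F.al zv' ay av' (fun q _ _ hq => by have := z₁ q hq; omega) (fun q _ _ hq => by omega)
          (fun k q _ _ _ _ hq => by
            rcases eq_or_ne k m with rfl | hk
            · have := hm q (by omega) (by omega) hq; omega
            · have := H k q (by omega) (by omega) (by omega) (by omega) hq; omega)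
          (fun k q _ _ _ _ hq => by
            rcases eq_or_ne k m with rfl | hk
            · omega
            · have := H k q (by omega) (by omega) (by omega) (by omega) hq; omega)
        omega
    have E₂ := F.arc_wrap hG 1 m v' x le_rfl (by omega) (by omega) (by omega) (by omega) (by omega)
      (by omega) ax av' (fun k q _ _ _ _ _ hq => by
        rcases eq_or_ne k m with rfl | hk
        · have := hm q (by omega) (by omega) hq; omega
        · have := H k q (by omega) (by omega) (by omega) (by omega) hq; omega)
    have E₃ := F.apex hG j m w w v' v' (by omega) (by omega) (by omega) (by omega) (by omega)
      zw zv' aj av' (fun q _ _ hq => by omega) (fun q _ _ hq => by omega)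
      (fun k q _ _ _ _ hq => by
        rcases eq_or_ne k m with rfl | hk
        · have := hm q (by omega) (by omega) hq; omega
        · have := H₂ k q (by omega) (by omega) (by omega) (by omega) hq; omega)
      (fun k q _ _ _ _ hq => by
        rcases eq_or_ne k m with rfl | hk
        · omega
        · have := H₂ k q (by omega) (by omega) (by omega) (by omega) hq; omega)
    rcases hvv with rfl | rfl
    · have := F.arc_wrap hG j m v' w (by omega) (by omega) (by omega) (by omega) (by omega)
        (by omega) (by omega) aj av' (fun k q _ _ _ _ _ hq => by
          rcases eq_or_ne k m with rfl | hk
          · have := hm q (by omega) (by omega) hq; omega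
          · have := H₂ k q (by omega) (by omega) (by omega) (by omega) hq; omega)
      omega
    · have := F.arc hG j m w v (by omega) (by omega) (by omega) (by omega) (by omega) aj av
        (fun k q _ _ _ _ hq => by
          rcases eq_or_ne k m with rfl | hk
          · have := hm q (by omega) (by omega) hq; omega
          · have := H₂ k q (by omega) (by omega) (by omega) (by omega) hq; omega)
      omega
  · have hwb := heq rfl
    clear hlt heq
    obtain ⟨s, y, hs, hsc, hy, hyc, hsy, as, ay', hm⟩ := F.last_nbrs hG
    rcases hm with hm | ⟨hsy', hs2, hy2, v, hv, hvN, hvbc, zv, av, hm⟩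
    · have J := F.arc_wrap hG 1 m y x le_rfl (by omega) (by omega) (by omega) (by omega) (by omega)
        (by omega) ax ay' (fun k q _ _ _ _ _ hq => by
          rcases eq_or_ne k m with rfl | hk
          · have := hm q (by omega) (by omega) hq; omega
          · have := H k q (by omega) (by omega) (by omega) (by omega) hq; omega)
      have T : (x + c + y + m) % 2 = 0 := by
        by_cases hcN : c = N
        · omega
        have := F.apex hG 1 m ℓ (x + 1) c y le_rfl (by omega) (by omega) (by omega) (by omega) F.al
          F.ac ay ay'
          (fun q _ _ hq => by have := z₁ q hq; omega) (fun q _ _ hq => by have := z₂ q hq; omega)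
          (fun k q _ _ _ _ hq => by
            rcases eq_or_ne k m with rfl | hk
            · have := hm q (by omega) (by omega) hq; omega
            · have := H k q (by omega) (by omega) (by omega) (by omega) hq; omega)
          (fun k q _ _ _ _ hq => by
            rcases eq_or_ne k m with rfl | hk
            · have := hm q (by omega) (by omega) hq; omega
            · have := H k q (by omega) (by omega) (by omega) (by omega) hq; omega)
        omega
      have E₁ := F.apex hG j m w w c y (by omega) (by omega) (by omega) (by omega) (by omega)
        zw F.ac aj ay' (fun q _ _ hq => by omega) (fun q _ _ hq => by have := z₂ q hq; omega)
        (fun k q _ _ _ _ hq => by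
          rcases eq_or_ne k m with rfl | hk
          · have := hm q (by omega) (by omega) hq; omega
          · have := H₂ k q (by omega) (by omega) (by omega) (by omega) hq; omega)
        (fun k q _ _ _ _ hq => by
          rcases eq_or_ne k m with rfl | hk
          · have := hm q (by omega) (by omega) hq; omega
          · have := H₂ k q (by omega) (by omega) (by omega) (by omega) hq; omega)
      have := F.arc_wrap hG j m y w (by omega) (by omega) (by omega) (by omega) (by omega)
        (by omega) (by omega) aj ay' (fun k q _ _ _ _ _ hq => by
          rcases eq_or_ne k m with rfl | hk
          · have := hm q (by omega) (by omega) hq; omega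
          · have := H₂ k q (by omega) (by omega) (by omega) (by omega) hq; omega)
      omega
    · have J : v ≠ ℓ → (v ≤ b ∨ c < N) → v < y → (N + y + x + 1 + m) % 2 = 1 := fun _ _ _ =>
        F.arc_wrap hG 1 m y x le_rfl (by omega) (by omega) (by omega) (by omega) (by omega)
          (by omega) ax ay' (fun k q _ _ _ _ _ hq => by
            rcases eq_or_ne k m with rfl | hk
            · have := hm q (by omega) (by omega) hq; omega
            · have := H k q (by omega) (by omega) (by omega) (by omega) hq; omega)
      have T : v ≠ ℓ → (x + m) % 2 = 1 := by
        intro h1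
        by_cases hcN : c = N
        · have := J h1 (by omega) (by omega)
          omega
        have := F.apex hG 1 m ℓ (x + 1) c y le_rfl (by omega) (by omega) (by omega) (by omega) F.al
          F.ac ay ay'
          (fun q _ _ hq => by have := z₁ q hq; omega) (fun q _ _ hq => by have := z₂ q hq; omega)
          (fun k q _ _ _ _ hq => by
            rcases eq_or_ne k m with rfl | hk
            · have := hm q (by omega) (by omega) hq; omega
            · have := H k q (by omega) (by omega) (by omega) (by omega) hq; omega)
          (fun k q _ _ _ _ hq => by
            rcases eq_or_ne k m with rfl | hk
            · have := hm q (by omega) (by omega) hq; omega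
            · have := H k q (by omega) (by omega) (by omega) (by omega) hq; omega)
        omega
      by_cases hvw : v = w
      · subst hvw
        have := T (by omega)
        have := J (by omega) (by omega) (by omega)
        have := F.arc hG m m v s (by omega) (by omega) (by omega) (by omega) (by omega) av as
          (fun k q _ _ _ _ hq => by
            obtain rfl : k = m := by omega
            have := hm q (by omega) (by omega) hq; omega)
        omega
      have E₁ := F.apex hG j m w w c y (by omega) (by omega) (by omega) (by omega) (by omega)
        zw F.ac aj ay' (fun q _ _ hq => by omega) (fun q _ _ hq => by have := z₂ q hq; omega)
        (fun k q _ _ _ _ hq => by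
          rcases eq_or_ne k m with rfl | hk
          · have := hm q (by omega) (by omega) hq; omega
          · have := H₂ k q (by omega) (by omega) (by omega) (by omega) hq; omega)
        (fun k q _ _ _ _ hq => by
          rcases eq_or_ne k m with rfl | hk
          · have := hm q (by omega) (by omega) hq; omega
          · have := H₂ k q (by omega) (by omega) (by omega) (by omega) hq; omega)
      by_cases h1 : w + 2 ≤ v
      · have := F.apex hG j m w w v v (by omega) (by omega) (by omega) (by omega) (by omega)
          zw zv aj av (fun q _ _ hq => by omega) (fun q _ _ hq => by omega)
          (fun k q _ _ _ _ hq => by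
            rcases eq_or_ne k m with rfl | hk
            · have := hm q (by omega) (by omega) hq; omega
            · have := H₂ k q (by omega) (by omega) (by omega) (by omega) hq; omega)
          (fun k q _ _ _ _ hq => by
            rcases eq_or_ne k m with rfl | hk
            · omega
            · have := H₂ k q (by omega) (by omega) (by omega) (by omega) hq; omega)
        omega
      by_cases h2 : v + 2 ≤ w
      · have := F.apex hG j m w w (v + N) (v + N) (by omega) (by omega) (by omega) (by omega)
          (by omega) zw (by rw [hper]; exact zv) aj (by rw [hper]; exact av)
          (fun q _ _ hq => by omega) (fun q _ _ hq => by omega)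
          (fun k q _ _ _ _ hq => by
            rcases eq_or_ne k m with rfl | hk
            · have := hm q (by omega) (by omega) hq; omega
            · have := H₂ k q (by omega) (by omega) (by omega) (by omega) hq; omega)
          (fun k q _ _ _ _ hq => by
            obtain rfl : q = v + N := by omega
            rw [hper] at hq
            rcases eq_or_ne k m with rfl | hk
            · omega
            · have := H₂ k v (by omega) (by omega) (by omega) (by omega) hq; omega)
        omega
      have := T (by omega)
      by_cases h3 : v = w + 1
      · have := F.apex hG 1 m ℓ (x + 1) v v le_rfl (by omega) (by omega) (by omega) (by omega)
          F.al zv ay av (fun q _ _ hq => by have := z₁ q hq; omega) (fun q _ _ hq => by omega)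
          (fun k q _ _ _ _ hq => by
            rcases eq_or_ne k m with rfl | hk
            · have := hm q (by omega) (by omega) hq; omega
            · have := H k q (by omega) (by omega) (by omega) (by omega) hq; omega)
          (fun k q _ _ _ _ hq => by
            rcases eq_or_ne k m with rfl | hk
            · omega
            · have := H k q (by omega) (by omega) (by omega) (by omega) hq; omega)
        omega
      · have := F.apex hG 1 m 0 x v v le_rfl (by omega) (by omega) (by omega) (by omega)
          F.a0 zv ax av (fun q _ _ hq => by have := z₁ q hq; omega) (fun q _ _ hq => by omega)
          (fun k q _ _ _ _ hq => by
            rcases eq_or_ne k m with rfl | hk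
            · have := hm q (by omega) (by omega) hq; omega
            · have := H k q (by omega) (by omega) (by omega) (by omega) hq; omega)
          (fun k q _ _ _ _ hq => by
            rcases eq_or_ne k m with rfl | hk
            · omega
            · have := H k q (by omega) (by omega) (by omega) (by omega) hq; omega)
        omega

theorem reflect_adj (F : MinLink G a N ℓ b c n h p) {k q : ℤ} (hq : 0 ≤ q) (hq' : q ≤ N)
    (hadj : G.Adj (p k) (h (ℓ - q))) :
    ∃ r, 0 ≤ r ∧ r ≤ N ∧ (r = ℓ - q ∨ (r = ℓ - q + N ∧ ℓ < q)) ∧ G.Adj (p k) (h r) := by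
  have := F.two_le
  have := F.le_b
  have := F.lt_c
  have := F.le_N
  rcases le_or_gt q ℓ with h1 | h1
  · exact ⟨ℓ - q, by omega, by omega, .inl rfl, hadj⟩
  · exact ⟨ℓ - q + N, by omega, by omega, .inr ⟨rfl, h1⟩, by rw [F.cyc.per]; exact hadj⟩

/-- The case where a single attachment of the path lies far from the neighbours of `p 1`. -/
theorem false_of_attach_far (F : MinLink G a N ℓ b c n h p) (hG : EvenHoleFree G) {x i w : ℤ}
    (hx : 0 ≤ x) (hxl : x < ℓ) (ax : G.Adj (p 1) (h x)) (ay : G.Adj (p 1) (h (x + 1)))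
    (hi : 1 ≤ i) (hin : i < n) (hw : ℓ + 2 ≤ w) (hwN : w + 2 ≤ N) (aw : G.Adj (p i) (h w))
    (zw : G.Adj a (h w)) (hxi : (x + i) % 2 = 0)
    (hall : ∀ k q, 1 ≤ k → k ≤ i → 0 ≤ q → q ≤ N → G.Adj (p k) (h q) →
      (k = 1 ∧ (q = x ∨ q = x + 1 ∨ (x = 0 ∧ q = N))) ∨ (k = i ∧ q = w)) : False := by
  have hN := F.hN
  have hper := F.cyc.per
  have hl := F.two_le
  have hl' := F.add_four_le hG
  have hb := F.le_b
  have hc := F.le_N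
  have hodd := F.basic hG
  obtain ⟨m, him, hmn, ⟨r, hr, hr', hrw, hr''⟩, hfirst⟩ := exists_first
    (P := fun k => ∃ q, 0 ≤ q ∧ q ≤ N ∧ q ≠ w ∧ G.Adj (p k) (h q)) (show i + 1 ≤ n by omega)
    (by
      obtain ⟨q, h1, h2, h3⟩ := F.w₂
      refine ⟨q, by omega, by omega, ?_, h3⟩
      rintro rfl
      have := F.sec₂ _ zw
      omega)
  have H : ∀ k q, 1 ≤ k → k < m → 0 ≤ q → q ≤ N → G.Adj (p k) (h q) →
      (k = 1 ∧ (q = x ∨ q = x + 1 ∨ (x = 0 ∧ q = N))) ∨ (i ≤ k ∧ q = w) := by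
    intro k q h1 h2 h3 h4 h5
    rcases le_or_gt k i with h6 | h6
    · have := hall k q h1 h6 h3 h4 h5
      omega
    · by_contra hcon
      exact hfirst k (by omega) h2 ⟨q, h3, h4, fun h7 => hcon (.inr ⟨h6.le, h7⟩), h5⟩
  have hrefl : (m < n → ∃ q, 0 < q ∧ q < w ∧ G.Adj (p m) (h q)) → (m = n → c ≤ w) →
      False := by
    intro h1 h2
    refine F.reflect.false_of_attach_far_aux hG (x := ℓ - x - 1) (i := i) (w := N + ℓ - w)
      (m := m) (by omega) (by omega) (by convert ay using 2; omega) (by convert ax using 2; omega)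
      hi (by omega) hmn (by omega) (by omega) (by rw [← hper]; convert aw using 2; omega)
      (by rw [← hper]; convert zw using 2; omega) (by omega) ?_ ?_ (by omega)
    · intro k q h3 h4 h5 h6 h7
      obtain ⟨r, h8, h9, h10, h11⟩ := F.reflect_adj h5 h6 h7
      have := H k r h3 h4 h8 h9 h11
      omega
    · intro h3
      obtain ⟨q, h4, h5, h6⟩ := h1 h3
      have : ℓ ≤ q := by
        have h7 := F.nbr (by omega) (k := m) (q := q) (by omega) (by omega) (by omega) (by omega) h6
        have := F.sec₁ q
        by_contra! hcon
        rcases h7 with h7 | h7 | h7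
        · have := F.sec₁ q h7
          omega
        · omega
        · omega
      exact ⟨N + ℓ - q, by omega, by omega, by rw [← hper]; convert h6 using 2; omega⟩
  have haux := F.false_of_attach_far_aux hG hx hxl ax ay hi (by omega) hmn hw hwN aw zw hxi H
  rcases hmn.lt_or_eq with h1 | h1
  · rcases lt_or_gt_of_ne hrw with h2 | h2
    · rcases hr.lt_or_eq with h3 | rfl
      · exact hrefl (fun _ => ⟨r, h3, h2, hr''⟩) (by omega)
      · exact haux (fun _ => ⟨N, by omega, le_rfl, hN ▸ hr''⟩) (by omega)
    · exact haux (fun _ => ⟨r, h2, hr', hr''⟩) (by omega)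
  · rcases F.sec₂ _ zw with h2 | h2
    · exact haux (by omega) (fun _ => h2)
    · exact hrefl (by omega) (fun _ => h2)

theorem first_not_far (F : MinLink G a N ℓ b c n h p) (hG : EvenHoleFree G) :
    ∃ x y, 0 ≤ x ∧ x < ℓ ∧ 0 < y ∧ y ≤ ℓ ∧ (y = x ∨ y = x + 1) ∧ G.Adj (p 1) (h x) ∧
      G.Adj (p 1) (h y) ∧ ∀ q, 0 ≤ q → q ≤ N → G.Adj (p 1) (h q) →
        q = x ∨ q = y ∨ (x = 0 ∧ q = N) := by
  have hN := F.hN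
  have hl := F.two_le
  have hl' := F.add_four_le hG
  have hn := F.two_le_n hG
  rcases F.first_nbrs hG with ⟨x, h1, h2, h3, h4⟩ | ⟨x, h1, h2, h3, h3', h4 | ⟨w, hw, hw', hx, zw, aw, h4⟩⟩
  · refine ⟨x, x, h1.le, h2, h1, h2.le, .inl rfl, h3, h3, fun q hq hq' hq'' => ?_⟩
    rcases hq'.lt_or_eq with h5 | rfl
    · exact .inl (h4 q hq h5 hq'')
    · have := h4 0 le_rfl (by omega) (hN ▸ hq'')
      omega
  · refine ⟨x, x + 1, h1, h2, by omega, by omega, .inr rfl, h3, h3', fun q hq hq' hq'' => ?_⟩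
    rcases hq'.lt_or_eq with h5 | rfl
    · have := h4 q hq h5 hq''
      omega
    · have := h4 0 le_rfl (by omega) (hN ▸ hq'')
      omega
  · refine (F.false_of_attach_far hG h1 h2 h3 h3' le_rfl (by omega) hw hw' aw zw (by omega)
      fun k q hk hk' hq hq' hq'' => ?_).elim
    obtain rfl : k = 1 := by omega
    rcases hq'.lt_or_eq with h5 | rfl
    · have := h4 q hq h5 hq''
      omega
    · have := h4 0 le_rfl (by omega) (hN ▸ hq'')
      omega

theorem not_attach (F : MinLink G a N ℓ b c n h p) (hG : EvenHoleFree G) {k r : ℤ}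
    (hk : 2 ≤ k) (hkn : k < n) (hr : 0 ≤ r) (hr' : r ≤ N) : ¬ G.Adj (p k) (h r) := by
  intro hadj
  have hN := F.hN
  have hl := F.two_le
  have hl' := F.add_four_le hG
  obtain ⟨x, y, hx, hxl, hy, hyl, hxy, ax, ay, h1⟩ := F.first_not_far hG
  obtain ⟨i, hi, hik, ⟨s, hs, hs', hs''⟩, hfirst⟩ := exists_first
    (P := fun k => ∃ q, 0 ≤ q ∧ q ≤ N ∧ G.Adj (p k) (h q)) hk ⟨r, hr, hr', hadj⟩
  obtain ⟨w, w', hw, hww, hw', aw, aw', zw, zw', hm⟩ := F.mid_nbrs hG hi (by omega) hs hs' hs''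
  have hall : ∀ k q, 1 ≤ k → k ≤ i → 0 ≤ q → q ≤ N → G.Adj (p k) (h q) →
      (k = 1 ∧ (q = x ∨ q = y ∨ (x = 0 ∧ q = N))) ∨
        (k = i ∧ (q = w ∨ q = w' ∨ (w' = N ∧ q = 0))) := by
    intro k q h2 h3 h4 h5 h6
    rcases h2.lt_or_eq with h2 | rfl
    · rcases h3.lt_or_eq with h3 | rfl
      · exact (hfirst k (by omega) h3 ⟨q, h4, h5, h6⟩).elim
      · exact .inr ⟨rfl, hm q h4 h5 h6⟩
    · exact .inl ⟨rfl, h1 q h4 h5 h6⟩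
  rcases F.first_attach hG hx hxl hy hyl hxy ax ay hi (by omega) hw hww hw' aw aw' zw zw' hall with
    ⟨rfl, rfl⟩ | ⟨rfl, rfl⟩ | ⟨rfl, rfl, h2, h3, h4⟩
  · refine F.false_of_attach_end hG ay hi (by omega) aw fun k q h2 h3 h4 h5 h6 => ?_
    have := hall k q h2 h3 h4 h5 h6
    omega
  · refine F.reflect.false_of_attach_end hG ax hi (by omega)
      (by rw [← F.cyc.per]; convert aw' using 2; omega) fun k q h2 h3 h4 h5 h6 => ?_
    obtain ⟨t, h7, h8, h9, h10⟩ := F.reflect_adj h4 h5 h6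
    have := hall k t h2 h3 h7 h8 h10
    omega
  · refine F.false_of_attach_far hG hx hxl ax ay (by omega) (by omega) h2 h3 aw zw h4
      fun k q h2 h3 h4 h5 h6 => ?_
    have := hall k q h2 h3 h4 h5 h6
    omega

theorem last_not_far (F : MinLink G a N ℓ b c n h p) (hG : EvenHoleFree G) :
    ∃ x y, b ≤ x ∧ x < c ∧ b < y ∧ y ≤ c ∧ (y = x ∨ y = x + 1) ∧ G.Adj (p n) (h x) ∧
      G.Adj (p n) (h y) ∧ ∀ q, 0 ≤ q → q ≤ N → G.Adj (p n) (h q) →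
        q = x ∨ q = y ∨ (y = N ∧ q = 0) := by
  have hl := F.two_le
  have hb := F.le_b
  have hc := F.le_N
  have e1 : n + 1 - 1 = n := by omega
  obtain ⟨x, y, h1, h2, h3, h4, h5, ax, ay, hall⟩ := F.swap.first_not_far hG
  simp only [e1] at ax ay hall
  refine ⟨x + b, y + b, by omega, by omega, by omega, by omega, by omega, ax, ay,
    fun q hq hq' hq'' => ?_⟩
  rcases le_or_gt b q with h6 | h6
  · have := hall (q - b) (by omega) (by omega) (by simpa using hq'')
    omega
  · have := hall (q - b + N) (by omega) (by omega) (by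
      rw [show q - b + N + b = q + N by omega, F.cyc.per]; exact hq'')
    omega

set_option maxHeartbeats 1000000 in
theorem false (F : MinLink G a N ℓ b c n h p) (hG : EvenHoleFree G) : False := by
  have hl := F.two_le
  have hl' := F.add_four_le hG
  have hn := F.two_le_n hG
  have hb := F.le_b
  have hbc := F.lt_c
  have hc := F.le_N
  have hodd := F.basic hG
  have z₁ := F.sec₁
  have z₂ := F.sec₂
  have hexc₁ := F.exc₁
  have hexc₂ := F.exc₂
  obtain ⟨x, y, hx, hxl, hy, hyl, hxy, ax, ay, h1⟩ := F.first_not_far hG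
  obtain ⟨s, t, hs, hsc, ht, htc, hst, as, at', h2⟩ := F.last_not_far hG
  have hall : ∀ k q, 1 ≤ k → k ≤ n → 0 ≤ q → q ≤ N → G.Adj (p k) (h q) →
      (k = 1 ∧ (q = x ∨ q = y ∨ (x = 0 ∧ q = N))) ∨
        (k = n ∧ (q = s ∨ q = t ∨ (t = N ∧ q = 0))) := by
    intro k q h3 h4 h5 h6 h7
    rcases h3.lt_or_eq with h3 | rfl
    · rcases h4.lt_or_eq with h4 | rfl
      · exact (F.not_attach hG (by omega) h4 h5 h6 h7).elim
      · exact .inr ⟨rfl, h2 q h5 h6 h7⟩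
    · exact .inl ⟨rfl, h1 q h5 h6 h7⟩
  have J₁ := F.arc_wrap hG 1 n t x le_rfl (by omega) le_rfl (by omega) (by omega) (by omega)
    (by omega) ax at' (fun k q _ _ _ _ _ hq => by
      have := hall k q (by omega) (by omega) (by omega) (by omega) hq; omega)
  have J₂ := F.arc hG 1 n y s le_rfl (by omega) le_rfl (by omega) (by omega) ay as
    (fun k q _ _ _ _ hq => by
      have := hall k q (by omega) (by omega) (by omega) (by omega) hq; omega)
  have Rst : c + 2 ≤ N → (0 + x + c + t + 1 + n) % 2 = 1 := fun _ =>
    F.apex hG 1 n 0 x c t le_rfl (by omega) le_rfl (by omega) (by omega) F.a0 F.ac ax at'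
      (fun q _ _ hq => by have := z₁ q hq; omega) (fun q _ _ hq => by have := z₂ q hq; omega)
      (fun k q _ _ _ _ hq => by
        have := hall k q (by omega) (by omega) (by omega) (by omega) hq; omega)
      (fun k q _ _ _ _ hq => by
        have := hall k q (by omega) (by omega) (by omega) (by omega) hq; omega)
  have Rts : ℓ + 2 ≤ b → (ℓ + y + b + s + 1 + n) % 2 = 1 := fun _ =>
    F.apex hG 1 n ℓ y b s le_rfl (by omega) le_rfl (by omega) (by omega) F.al F.ab ay as
      (fun q _ _ hq => by have := z₁ q hq; omega) (fun q _ _ hq => by have := z₂ q hq; omega)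
      (fun k q _ _ _ _ hq => by
        have := hall k q (by omega) (by omega) (by omega) (by omega) hq; omega)
      (fun k q _ _ _ _ hq => by
        have := hall k q (by omega) (by omega) (by omega) (by omega) hq; omega)
  have Rss : x + 2 ≤ b → s + 2 ≤ N → (0 + x + b + s + 1 + n) % 2 = 1 := fun _ _ =>
    F.apex hG 1 n 0 x b s le_rfl (by omega) le_rfl (by omega) (by omega) F.a0 F.ab ax as
      (fun q _ _ hq => by have := z₁ q hq; omega) (fun q _ _ hq => by have := z₂ q hq; omega)
      (fun k q _ _ _ _ hq => by
        have := hall k q (by omega) (by omega) (by omega) (by omega) hq; omega)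
      (fun k q _ _ _ _ hq => by
        have := hall k q (by omega) (by omega) (by omega) (by omega) hq; omega)
  have Rtt : ℓ + 2 ≤ t → c + 2 ≤ y + N → (ℓ + y + c + t + 1 + n) % 2 = 1 := fun _ _ =>
    F.apex hG 1 n ℓ y c t le_rfl (by omega) le_rfl (by omega) (by omega) F.al F.ac ay at'
      (fun q _ _ hq => by have := z₁ q hq; omega) (fun q _ _ hq => by have := z₂ q hq; omega)
      (fun k q _ _ _ _ hq => by
        have := hall k q (by omega) (by omega) (by omega) (by omega) hq; omega)
      (fun k q _ _ _ _ hq => by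
        have := hall k q (by omega) (by omega) (by omega) (by omega) hq; omega)
  clear hall h1 h2 z₁ z₂
  by_cases h3 : c = N - 1
  · have := Rts (by omega)
    rcases hxy with rfl | rfl
    · have := Rss (by omega) (by omega)
      omega
    · have := Rtt (by omega) (by omega)
      omega
  · have h4 : b = ℓ + 1 := by
      by_contra h4
      have h5 : c % 2 = 1 := by
        by_cases h6 : c = N
        · omega
        · have := Rst (by omega)
          omega
      have := Rts (by omega)
      omega
    have := Rst (by omega)
    rcases hxy with rfl | rfl
    · have := Rtt (by omega) (by omega)
      omega
    · have := Rss (by omega) (by omega)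
      omega

end MinLink

theorem Link.false {G : SimpleGraph V} {a : V} {N ℓ b c n : ℤ} {h p : ℤ → V}
    (F : Link G a N ℓ b c n h p) (hG : EvenHoleFree G) : False := by
  have hP : ∃ m : ℕ, ∃ N ℓ b c h p, Link G a N ℓ b c (m : ℤ) h p :=
    ⟨n.toNat, N, ℓ, b, c, h, p, by rwa [Int.toNat_of_nonneg (by have := F.one_le; omega)]⟩
  classical
  obtain ⟨N', ℓ', b', c', h', p', F'⟩ := Nat.find_spec hP
  refine MinLink.false (G := G) (a := a) ⟨F', fun N₁ ℓ₁ b₁ c₁ n₁ h₁ p₁ F₁ => ?_⟩ hG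
  have := F₁.one_le
  have := Nat.find_min' hP (m := n₁.toNat)
    ⟨N₁, ℓ₁, b₁, c₁, h₁, p₁, by rwa [Int.toNat_of_nonneg (by omega)]⟩
  omega

theorem IsCyc.shift {G : SimpleGraph V} {N : ℤ} {h : ℤ → V} (H : IsCyc G N h) (d : ℤ) :
    IsCyc G N fun q => h (q + d) where
  four := H.four
  per i := by rw [show i + N + d = i + d + N by omega, H.per]
  adj i := by rw [show i + 1 + d = i + d + 1 by omega]; exact H.adj _
  nadj i j hij hji := H.nadj _ _ (by omega) (by omega)
  inj i j hij hji := H.inj _ _ (by omega) (by omega)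

theorem IsCyc.exists_mem_range {G : SimpleGraph V} {N : ℤ} {h : ℤ → V} (H : IsCyc G N h)
    (i q : ℤ) : ∃ r, i ≤ r ∧ r < i + N ∧ h r = h q := by
  have h4 := H.four
  refine ⟨i + (q - i) % N, by have := Int.emod_nonneg (q - i) (show N ≠ 0 by omega); omega,
    by have := Int.emod_lt_of_pos (q - i) (show 0 < N by omega); omega, ?_⟩
  have hper : Function.Periodic h N := H.per
  have := hper.sub_zsmul_eq ((q - i) / N) (x := q)
  rw [← this, smul_eq_mul, mul_comm]
  congr 1
  have := Int.mul_ediv_add_emod (q - i) N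
  omega

/-- A shortest path avoiding the closed neighbourhood of `a` between two arcs of a cycle. -/
theorem IsCyc.exists_path {G : SimpleGraph V} {a : V} {N ℓ : ℤ} {h : ℤ → V} (H : IsCyc G N h)
    (hns : ¬ FullStarCutset G a) (ah : ∀ q, a ≠ h q) (a0 : G.Adj a (h 0)) (al : G.Adj a (h ℓ))
    {r₀ q₀ : ℤ} (hr₀ : 0 < r₀) (hr₀' : r₀ < ℓ) (hr₀'' : ¬ G.Adj a (h r₀)) (hq₀ : ℓ < q₀)
    (hq₀' : q₀ < N) (hq₀'' : ¬ G.Adj a (h q₀)) :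
    ∃ (n : ℤ) (p : ℤ → V), 1 ≤ n ∧
      (∀ k l, 1 ≤ k → k < l → l ≤ n → p k ≠ p l ∧ (G.Adj (p k) (p l) ↔ l = k + 1)) ∧
      (∀ k, 1 ≤ k → k ≤ n → a ≠ p k ∧ ¬ G.Adj a (p k)) ∧
      (∀ k q, 1 ≤ k → k ≤ n → p k ≠ h q) ∧
      (∃ r, 0 < r ∧ r < ℓ ∧ G.Adj (p 1) (h r)) ∧
      ∃ q, ℓ < q ∧ q < N ∧ ¬ G.Adj a (h q) ∧ G.Adj (p n) (h q) := by
  let T : ℕ → (ℕ → V) → Prop := fun L g => (∃ r, 0 < r ∧ r < ℓ ∧ g 0 = h r) ∧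
    (∀ k ≤ L, a ≠ g k ∧ ¬ G.Adj a (g k)) ∧ ∀ k < L, G.Adj (g k) (g (k + 1))
  have hreach : ∃ (L : ℕ) (g : ℕ → V), T L g ∧ ∃ q, ℓ < q ∧ q < N ∧ g L = h q := by
    by_contra hcon
    refine hns ⟨{v | ∃ L g, T L g ∧ g L = v}, {v | v ∉ closedNbhd G a ∧ ¬ ∃ L g, T L g ∧ g L = v},
      ⟨h r₀, 0, fun _ => h r₀, ⟨⟨r₀, hr₀, hr₀', rfl⟩, fun _ _ => ⟨ah _, hr₀''⟩,
        fun k hk => absurd hk (by omega)⟩, rfl⟩,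
      ⟨h q₀, ?_, ?_⟩, ?_, ?_, ?_⟩
    · simp only [closedNbhd, Set.mem_insert_iff, mem_neighborSet, not_or]
      exact ⟨(ah _).symm, hq₀''⟩
    · rintro ⟨L, g, hT, hL⟩
      exact hcon ⟨L, g, hT, q₀, hq₀, hq₀', hL⟩
    · exact Set.disjoint_left.2 fun v hv hv' => hv'.2 hv
    · ext v
      simp only [Set.mem_union, Set.mem_ofPred_eq, Set.mem_compl_iff]
      constructor
      · rintro (⟨L, g, hT, rfl⟩ | h1)
        · have := hT.2.1 L le_rfl
          simp only [closedNbhd, Set.mem_insert_iff, mem_neighborSet, not_or]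
          exact ⟨this.1.symm, this.2⟩
        · exact h1.1
      · intro h1
        by_cases h2 : ∃ L g, T L g ∧ g L = v
        · exact .inl h2
        · exact .inr ⟨h1, h2⟩
    · rintro x ⟨L, g, hT, rfl⟩ y ⟨hy, hy'⟩ hadj
      simp only [closedNbhd, Set.mem_insert_iff, mem_neighborSet, not_or] at hy
      refine hy' ⟨L + 1, fun k => if k ≤ L then g k else y, ⟨?_, fun k hk => ?_, fun k hk => ?_⟩,
        by simp⟩
      · simpa using hT.1
      · by_cases h1 : k ≤ L
        · simpa [h1] using hT.2.1 k h1
        · simpa [h1] using ⟨fun h => hy.1 h.symm, hy.2⟩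
      · by_cases h1 : k + 1 ≤ L
        · simpa [h1, show k ≤ L by omega] using hT.2.2 k h1
        · obtain rfl : k = L := by omega
          simpa using hadj
  classical
  obtain ⟨g, hT, q, hq, hqN, hgq⟩ := Nat.find_spec hreach
  have hmin := fun m => Nat.find_min' hreach (m := m)
  generalize Nat.find hreach = L at hT hgq hmin
  obtain ⟨⟨r, hr, hrl, hgr⟩, hav, hadj⟩ := hT
  have hind : ∀ k l, k < l → l ≤ L → G.Adj (g k) (g l) → l = k + 1 := by
    intro k l hkl hl h1
    by_contra h2
    have := hmin (k + 1 + (L - l)) ⟨fun t => if t ≤ k then g t else g (t + (l - k - 1)),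
      ⟨⟨r, hr, hrl, by simpa using hgr⟩, fun t ht => ?_, fun t ht => ?_⟩, q, hq, hqN, ?_⟩
    · omega
    · by_cases h3 : t ≤ k
      · simpa [h3] using hav t (by omega)
      · simpa [h3] using hav (t + (l - k - 1)) (by omega)
    · by_cases h3 : t + 1 ≤ k
      · simpa [h3, show t ≤ k by omega] using hadj t (by omega)
      · by_cases h4 : t = k
        · subst h4
          simpa [show t + 1 + (l - t - 1) = l by omega] using h1
        · simpa [h3, show ¬ t ≤ k by omega, show t + 1 + (l - k - 1) = t + (l - k - 1) + 1 by omega]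
            using hadj (t + (l - k - 1)) (by omega)
    · beta_reduce
      rw [if_neg (by omega), ← hgq]
      congr 1
      omega
  have hoff : ∀ k, 0 < k → k < L → ∀ s, g k ≠ h s := by
    intro k hk hkL s h1
    obtain ⟨s', h2, h3, h4⟩ := H.exists_mem_range 0 s
    rw [← h4] at h1
    have h5 := (hav k hkL.le).2
    rw [h1] at h5
    have h6 : s' ≠ 0 := fun h => h5 (h ▸ a0)
    have h7 : s' ≠ ℓ := fun h => h5 (h ▸ al)
    rcases lt_or_gt_of_ne h7 with h8 | h8
    · have := hmin (L - k) ⟨fun t => g (t + k), ⟨⟨s', by omega, h8, by simpa using h1⟩,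
        fun t ht => hav _ (by omega), fun t ht => by
          simpa [show t + 1 + k = t + k + 1 by omega] using hadj (t + k) (by omega)⟩,
        q, hq, hqN, by simpa [show L - k + k = L by omega] using hgq⟩
      omega
    · have := hmin k ⟨g, ⟨⟨r, hr, hrl, hgr⟩, fun t ht => hav t (by omega),
        fun t ht => hadj t (by omega)⟩, s', h8, by omega, h1⟩
      omega
  have hL : 2 ≤ L := by
    by_contra hL
    obtain rfl | rfl : L = 0 ∨ L = 1 := by omega
    · exact H.inj r q (by omega) (by omega) (hgr.symm.trans hgq)
    · have := hadj 0 (by omega)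
      rw [hgr, zero_add, hgq] at this
      exact H.nadj r q (by omega) (by omega) this
  refine ⟨L - 1, fun k => g k.toNat, by omega, fun k l hk hkl hl => ⟨fun h1 => ?_, fun h1 => ?_,
    ?_⟩, fun k hk hk' => hav _ (by omega), fun k s hk hk' => hoff _ (by omega) (by omega) s,
    ⟨r, hr, hrl, ?_⟩, q, hq, hqN, ?_, ?_⟩
  · have h2 := hadj l.toNat (by omega)
    simp only at h1
    rw [← h1] at h2
    have := hind _ _ (by omega) (by omega) h2
    omega
  · have := hind _ _ (by omega) (by omega) h1
    omega
  · rintro rfl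
    simpa [show (k + 1).toNat = k.toNat + 1 by omega] using hadj k.toNat (by omega)
  · have := (hadj 0 (by omega)).symm
    rwa [hgr] at this
  · rw [← hgq]
    exact (hav L le_rfl).2
  · have := hadj (L - 1) (by omega)
    rwa [show L - 1 + 1 = L by omega, hgq, show L - 1 = ((L : ℤ) - 1).toNat by omega] at this

theorem IsCyc.nbrs_of_no_fullStarCutset {G : SimpleGraph V} (hG : EvenHoleFree G) {a : V} {N : ℤ}
    {h : ℤ → V} (H : IsCyc G N h) (hns : ¬ FullStarCutset G a) (ah : ∀ q, a ≠ h q) :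
    (∀ q, G.Adj a (h q)) ∨ (∀ q, ¬ G.Adj a (h q)) ∨
      (∃ i m, 0 ≤ m ∧ m + 2 ≤ N ∧ ∀ q, i ≤ q → q < i + N → (G.Adj a (h q) ↔ q ≤ i + m)) ∨
      ∃ i d, 2 ≤ d ∧ d < N ∧
        ∀ q, i ≤ q → q < i + N → (G.Adj a (h q) ↔ q = i ∨ q = i + 1 ∨ q = i + d) := by
  by_cases hc : ∀ q, G.Adj a (h q)
  · exact .inl hc
  by_cases ha : ∀ q, ¬ G.Adj a (h q)
  · exact .inr (.inl ha)
  push Not at hc ha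
  obtain ⟨q₁, hq₁⟩ := hc
  obtain ⟨q₂, hq₂⟩ := ha
  obtain ⟨q₃, h1, h2, h3⟩ := H.exists_mem_range q₂ q₁
  rw [← h3] at hq₁
  obtain ⟨s, t, hs, hsq, hqt, ht, as, at', hst⟩ := exists_sector (P := fun q => G.Adj a (h q)) h1
    h2.le hq₂ (by rw [H.per]; exact hq₂) hq₁
  have H' := H.shift s
  have F : ∀ (h' : ℤ → V), (h' = fun q => h (q + s)) → ∀ ℓ, ℓ = t - s →
      (∃ i m, 0 ≤ m ∧ m + 2 ≤ N ∧ ∀ q, i ≤ q → q < i + N → (G.Adj a (h' q) ↔ q ≤ i + m)) ∨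
      ∃ i d, 2 ≤ d ∧ d < N ∧
        ∀ q, i ≤ q → q < i + N → (G.Adj a (h' q) ↔ q = i ∨ q = i + 1 ∨ q = i + d) := by
    rintro h' hh' ℓ hℓ
    rw [← hh'] at H'
    have ah' : ∀ q, a ≠ h' q := fun q => by rw [hh']; exact ah _
    have a0 : G.Adj a (h' 0) := by simpa [hh'] using as
    have al : G.Adj a (h' ℓ) := by simpa [hh', hℓ] using at'
    have hsec : ∀ q, G.Adj a (h' q) → q ≤ 0 ∨ ℓ ≤ q := fun q hq => by
      rw [hh'] at hq
      have := hst _ hq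
      omega
    have hN : h' N = h' 0 := by have := H'.per 0; rwa [zero_add] at this
    have hlN : ℓ ≤ N := by omega
    have h2l : 2 ≤ ℓ := by omega
    clear hst as at' hq₁ hq₂ h1 h2 h3 hs hsq hqt ht hh' hℓ
    by_cases hall : ∀ q, ℓ ≤ q → q ≤ N → G.Adj a (h' q)
    · refine .inl ⟨ℓ, N - ℓ, by omega, by omega, fun q hq hq' => ⟨fun h1 => ?_, fun h1 =>
        hall q hq (by omega)⟩⟩
      have h2 : G.Adj a (h' (q - N)) := by
        rwa [← H'.per, show q - N + N = q by omega]
      have := hsec _ h2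
      omega
    push Not at hall
    obtain ⟨q₀, hq₀, hq₀', hq₀''⟩ := hall
    have h1 : q₀ ≠ ℓ := fun h => hq₀'' (h ▸ al)
    have h2 : q₀ ≠ N := fun h => hq₀'' (by rw [h, hN]; exact a0)
    obtain ⟨n, p, hn, hpp, hap, hph, hw₁, q, hq, hqN, haq, hpq⟩ := H'.exists_path hns ah' a0 al
      (r₀ := 1) (q₀ := q₀) (by omega) (by omega)
      (fun h => by have := hsec _ h; omega) (by omega) (by omega) hq₀''
    obtain ⟨b, c, hb, hbq, hqc, hc, ab, ac, hsec₂⟩ := exists_sector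
      (P := fun q => G.Adj a (h' q)) hq.le hqN.le al (hN ▸ a0) haq
    by_cases e₁ : b = ℓ ∧ c = N - 1
    · obtain ⟨rfl, rfl⟩ := e₁
      refine .inr ⟨N - 1, b + 1, by omega, by omega, fun r hr hr' => ⟨fun h3 => ?_, ?_⟩⟩
      · have h4 : G.Adj a (h' (r - N)) := by
          rwa [← H'.per, show r - N + N = r by omega]
        have := hsec _ h4
        have := hsec₂ _ h4
        omega
      · rintro (rfl | rfl | rfl)
        · exact ac
        · rwa [show N - 1 + 1 = N by omega, hN]
        · rwa [show N - 1 + (b + 1) = b + N by omega, H'.per]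
    by_cases e₂ : b = ℓ + 1 ∧ c = N
    · obtain ⟨rfl, rfl⟩ := e₂
      refine .inr ⟨ℓ, c - ℓ, by omega, by omega, fun r hr hr' => ⟨fun h3 => ?_, ?_⟩⟩
      · have h4 : G.Adj a (h' (r - c)) := by
          rwa [← H'.per, show r - c + c = r by omega]
        have := hsec _ h4
        have := hsec₂ _ h3
        omega
      · rintro (rfl | rfl | rfl)
        · exact al
        · exact ab
        · rwa [show ℓ + (c - ℓ) = c by omega]
    exact (Link.false (N := N) (ℓ := ℓ) (b := b) (c := c) (n := n) (h := h') (p := p) (a := a)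
      (G := G) ⟨H', h2l, hb, by omega, hc, a0, al, ab, ac, hsec, hsec₂, ah', e₁, e₂, hn, hpp, hap,
        hph, hw₁, q, hbq, hqc, hpq⟩ hG).elim
  rcases F _ rfl _ rfl with ⟨i, m, h1, h2, h3⟩ | ⟨i, d, h1, h2, h3⟩
  · refine .inr (.inr (.inl ⟨i + s, m, h1, h2, fun q hq hq' => ?_⟩))
    have := h3 (q - s) (by omega) (by omega)
    rw [sub_add_cancel] at this
    rw [this]
    omega
  · refine .inr (.inr (.inr ⟨i + s, d, h1, h2, fun q hq hq' => ?_⟩))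
    have := h3 (q - s) (by omega) (by omega)
    rw [sub_add_cancel] at this
    rw [this]
    omega

theorem IsHole.exists_isCyc {G : SimpleGraph V} {u : V} {c : G.Walk u u} (hc : IsHole G c) :
    ∃ N h, IsCyc G N h ∧ ∀ v, v ∈ c.support ↔ ∃ i, h i = v := by
  obtain ⟨hcyc, h4, hind⟩ := hc
  have hpos : (0 : ℤ) < c.length := by omega
  have h0 : c.getVert c.length = c.getVert 0 := by simp
  have hmod : ∀ i : ℤ, 0 ≤ i % c.length ∧ i % c.length < c.length := fun i =>
    ⟨Int.emod_nonneg _ hpos.ne', Int.emod_lt_of_pos _ hpos⟩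
  have hval : ∀ k : ℕ, k ≤ c.length → c.getVert ((k : ℤ) % c.length).toNat = c.getVert k := by
    intro k hk
    rcases hk.lt_or_eq with h1 | rfl
    · rw [Int.emod_eq_of_lt (by omega) (by omega)]
      simp
    · simp
  have hsucc : ∀ i : ℤ, c.getVert ((i + 1) % c.length).toNat =
      c.getVert ((i % c.length).toNat + 1) := by
    intro i
    have h1 := hmod i
    refine Eq.trans ?_ (hval _ (by omega))
    push_cast
    rw [Int.toNat_of_nonneg h1.1, Int.emod_add_emod]
  have hinj : ∀ i j : ℤ, c.getVert (i % c.length).toNat = c.getVert (j % c.length).toNat →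
      (c.length : ℤ) ∣ i - j := by
    intro i j h1
    have := hmod i
    have := hmod j
    have := hcyc.getVert_injOn' (by simp only [Set.mem_ofPred_eq]; omega)
      (by simp only [Set.mem_ofPred_eq]; omega) h1
    exact Int.ModEq.dvd (show j % c.length = i % c.length by omega)
  have hmem : ∀ k, c.getVert k ∈ c.support := fun k => c.getVert_mem_support k
  have hdvd : ∀ z : ℤ, (c.length : ℤ) ∣ z → -c.length < z → z < c.length → z = 0 :=
    fun z h1 h2 h3 => Int.eq_zero_of_abs_lt_dvd h1 (abs_lt.2 ⟨h2, h3⟩)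
  refine ⟨c.length, fun i => c.getVert (i % c.length).toNat, ⟨by omega, fun i => by simp,
    fun i => ?_, fun i j hij hji hadj => ?_, fun i j hij hji h1 => ?_⟩, fun v => ?_⟩
  · rw [hsucc]
    exact c.adj_getVert_succ (by have := hmod i; omega)
  · have h1 := hind _ _ (hmem _) (hmem _) hadj
    rw [← Walk.adj_toSubgraph_iff_mem_edges, Walk.toSubgraph_adj_iff] at h1
    obtain ⟨k, hk, hkl⟩ := h1
    have hk1 := hsucc k
    rw [Int.emod_eq_of_lt (by omega) (by omega : (k : ℤ) < c.length), Int.toNat_natCast] at hk1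
    rw [← hval k hkl.le, ← hk1, Sym2.eq_iff] at hk
    rcases hk with ⟨h1, h2⟩ | ⟨h1, h2⟩
    · have := hdvd (j - i - 1) (by
        have := dvd_sub (hinj _ _ h1) (hinj _ _ h2)
        rwa [show (k - i) - (k + 1 - j) = j - i - 1 by ring] at this) (by omega) (by omega)
      omega
    · have := hdvd (j - i + 1 - c.length) (by
        have := dvd_sub (dvd_sub (hinj _ _ h2) (hinj _ _ h1)) (dvd_refl (c.length : ℤ))
        rwa [show (k + 1 - i) - (k - j) - c.length = j - i + 1 - (c.length : ℤ) by ring] at this)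
        (by omega) (by omega)
      omega
  · have := hdvd _ (hinj _ _ h1) (by omega) (by omega)
    omega
  · rw [Walk.mem_support_iff_exists_getVert]
    constructor
    · rintro ⟨k, hk, hkl⟩
      exact ⟨k, by rw [← hk]; exact hval k hkl⟩
    · rintro ⟨i, hi⟩
      exact ⟨_, hi, by have := hmod i; omega⟩

theorem statement_4 {V : Type*} [Fintype V] (G : SimpleGraph V)
    (hG : EvenHoleFree G)
    (u : V) (c : G.Walk u u) (hc : IsHole G c) (a : V) (ha : a ∉ c.support)
    (hns : ¬ FullStarCutset G a) :
    (∀ x ∈ c.support, G.Adj a x) ∨ (∀ x ∈ c.support, ¬ G.Adj a x) ∨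
    (∃ (p q : V) (P : G.Walk p q), P.IsPath ∧
      (∀ x : V, x ∈ P.support ↔ x ∈ c.support ∧ G.Adj a x) ∧
      (∀ e ∈ P.edges, e ∈ c.edges) ∧
      (∀ x y : V, x ∈ P.support → y ∈ P.support → s(x, y) ∈ c.edges →
        s(x, y) ∈ P.edges)) ∨
    ({x : V | x ∈ c.support ∧ G.Adj a x}.ncard = 3 ∧
      ∃ x y : V, x ∈ c.support ∧ y ∈ c.support ∧ G.Adj a x ∧ G.Adj a y ∧
        G.Adj x y) := by
  obtain ⟨N, h, H, hs⟩ := hc.exists_isCyc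
  have hmem : ∀ i, h i ∈ c.support := fun i => (hs _).2 ⟨i, rfl⟩
  rcases H.nbrs_of_no_fullStarCutset hG hns fun q hq => ha (hq ▸ hmem q) with
    h1 | h1 | ⟨i, m, h0, h2, h1⟩ | ⟨i, d, h0, h2, h1⟩
  · refine .inl fun x hx => ?_
    obtain ⟨i, rfl⟩ := (hs x).1 hx
    exact h1 i
  · refine .inr (.inl fun x hx => ?_)
    obtain ⟨i, rfl⟩ := (hs x).1 hx
    exact h1 i
  · lift m to ℕ using h0
    let g : ℕ → V := fun t => h (i + t)
    have hg : ∀ t, G.Adj (g t) (g (t + 1)) := fun t => by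
      have := H.adj (i + t)
      rwa [add_assoc] at this
    have hsupp : ∀ x, x ∈ (walkOfFun G g hg m).support ↔ ∃ t ≤ m, g t = x := fun x => by
      simp [support_walkOfFun]
    refine .inr (.inr (.inl ⟨_, _, walkOfFun G g hg m,
      isPath_walkOfFun G g hg m fun s t hst ht => H.inj _ _ (by omega) (by omega),
      fun x => ?_, fun e he => ?_, fun x y hx hy hxy => ?_⟩))
    · rw [hsupp]
      constructor
      · rintro ⟨t, ht, rfl⟩
        exact ⟨hmem _, (h1 _ (by omega) (by omega)).2 (by omega)⟩
      · rintro ⟨hx, hax⟩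
        obtain ⟨q, rfl⟩ := (hs x).1 hx
        obtain ⟨r, hr, hr', hrq⟩ := H.exists_mem_range i q
        rw [← hrq] at hax ⊢
        have := (h1 r hr hr').1 hax
        exact ⟨(r - i).toNat, by omega, congrArg h (by omega)⟩
    · simp only [edges_walkOfFun, List.mem_map] at he
      obtain ⟨t, -, rfl⟩ := he
      exact hc.2.2 _ _ (hmem _) (hmem _) (hg t)
    · have key : ∀ s t : ℕ, s < t → t ≤ m → G.Adj (g s) (g t) →
          s(g s, g t) ∈ (walkOfFun G g hg m).edges := fun s t hst ht hadj => by
        obtain rfl : t = s + 1 := by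
          have := H.of_adj hadj
          omega
        rw [edges_walkOfFun, List.mem_map]
        exact ⟨s, List.mem_range.2 ht, rfl⟩
      have hadj := c.adj_of_mem_edges hxy
      obtain ⟨s, hs, rfl⟩ := (hsupp x).1 hx
      obtain ⟨t, ht, rfl⟩ := (hsupp y).1 hy
      rcases lt_trichotomy s t with hst | rfl | hst
      · exact key s t hst ht hadj
      · exact absurd hadj (G.loopless.irrefl _)
      · rw [Sym2.eq_swap]
        exact key t s hst hs hadj.symm
  · have ai := (h1 i le_rfl (by omega)).2 (.inl rfl)
    have ai' := (h1 (i + 1) (by omega) (by omega)).2 (.inr (.inl rfl))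
    have ad := (h1 (i + d) (by omega) (by omega)).2 (.inr (.inr rfl))
    refine .inr (.inr (.inr ⟨Set.ncard_eq_three.2 ⟨h i, h (i + 1), h (i + d),
      H.inj _ _ (by omega) (by omega), H.inj _ _ (by omega) (by omega),
      H.inj _ _ (by omega) (by omega), Set.ext fun x => ⟨fun hx => ?_, ?_⟩⟩,
      h i, h (i + 1), hmem _, hmem _, ai, ai', H.adj i⟩))
    · obtain ⟨hx, hax⟩ := hx
      obtain ⟨q, rfl⟩ := (hs x).1 hx
      obtain ⟨r, hr, hr', hrq⟩ := H.exists_mem_range i q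
      rw [← hrq] at hax ⊢
      rcases (h1 r hr hr').1 hax with rfl | rfl | rfl <;> simp
    · rintro (rfl | rfl | rfl)
      exacts [⟨hmem _, ai⟩, ⟨hmem _, ai'⟩, ⟨hmem _, ad⟩]

end EHF
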